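/- Let K be a field of characteristic zero and let d, D, n be positive integers with d ≤ D. Then there exists a nonempty Zariski open subset U ⊂ V_{n,d} × V_{n,D}^{n−1} such that for every g = (g_1, ..., g_n) ∈ U, the Newton polytope of the minimal polynomial of ⟨x' − g⟩^(∞) ∩ K[x_1^{(∞)}] is exactly the simplex of all (e_0, e_1, ..., e_n) ∈ ℝ_{≥0}^{n+1} satisfying e_0 + Σ_{k=1}^{n} (d + (k−1)(D−1)) e_k ≤ Π_{k=1}^{n} (d + (k−1)(D−1)). -/

import Mathlib

open MvPolynomial

noncomputable section

/-- The canonical derivation on the ring of differential polynomials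
`K[x_i^{(j)} : 1 ≤ i ≤ n, j ≥ 0]`, sending `x_i^{(j)}` to `x_i^{(j+1)}`. -/
def diffDer (K : Type*) [CommRing K] (n : ℕ) :
    Derivation K (MvPolynomial (Fin n × ℕ) K) (MvPolynomial (Fin n × ℕ) K) :=
  MvPolynomial.mkDerivation K fun v => X (v.1, v.2 + 1)

/-- The differential ideal generated by a set `S`: the ideal generated by all
derivatives of elements of `S`. -/
def diffIdeal (K : Type*) [CommRing K] (n : ℕ) (S : Set (MvPolynomial (Fin n × ℕ) K)) :
    Ideal (MvPolynomial (Fin n × ℕ) K) :=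
  Ideal.span {q | ∃ f ∈ S, ∃ j : ℕ, q = (⇑(diffDer K n))^[j] f}

/-- The differential ideal `I_g = ⟨x_1' - g_1, …, x_n' - g_n⟩^(∞)` of the
system `x' = g(x)`. -/
def sysIdeal (K : Type*) [CommRing K] (n : ℕ) (g : Fin n → MvPolynomial (Fin n) K) :
    Ideal (MvPolynomial (Fin n × ℕ) K) :=
  diffIdeal K n (Set.range fun i => X (i, 1) - rename (fun j => (j, 0)) (g i))

/-- The order of a differential polynomial: the largest `j` such that some variable
`x_i^{(j)}` appears. -/
def ordOf {K : Type*} [CommSemiring K] {n : ℕ} (f : MvPolynomial (Fin n × ℕ) K) : ℕ :=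
  f.vars.sup Prod.snd

/-- `f` is a minimal polynomial of the elimination ideal `I ∩ K[x_1^{(∞)}]`:
a nonzero element of `I` involving only the variables `x_1^{(j)}`, of minimal order and
then minimal total degree among all such elements. -/
def IsMinPoly (K : Type*) [Field K] (n : ℕ) [NeZero n]
    (I : Ideal (MvPolynomial (Fin n × ℕ) K)) (f : MvPolynomial (Fin n × ℕ) K) : Prop :=
  f ≠ 0 ∧ f ∈ I ∧ (∀ v ∈ f.vars, v.1 = (0 : Fin n)) ∧
    ∀ h : MvPolynomial (Fin n × ℕ) K, h ≠ 0 → h ∈ I → (∀ v ∈ h.vars, v.1 = (0 : Fin n)) →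
      ordOf f ≤ ordOf h ∧ (ordOf h ≤ ordOf f → f.totalDegree ≤ h.totalDegree)

/-- The set of exponent vectors `(e_0, …, e_ν)` of the monomials
`x_1^{e_0} (x_1')^{e_1} ⋯ (x_1^{(ν)})^{e_ν}` of a differential polynomial in `x_1`. -/
def expVecs (K : Type*) [CommSemiring K] (n ν : ℕ) [NeZero n]
    (f : MvPolynomial (Fin n × ℕ) K) : Set (Fin (ν + 1) → ℝ) :=
  {e | ∃ m ∈ f.support, e = fun k : Fin (ν + 1) => (m ((0 : Fin n), (k : ℕ)) : ℝ)}

/-- The Newton polytope of a differential polynomial in `x_1` of order at most `ν`. -/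
def newtonPolytope (K : Type*) [CommSemiring K] (n ν : ℕ) [NeZero n]
    (f : MvPolynomial (Fin n × ℕ) K) : Set (Fin (ν + 1) → ℝ) :=
  convexHull ℝ (expVecs K n ν f)

/-- The Lie derivative along the polynomial vector field `g`. -/
def lieDer {B : Type*} [CommRing B] {n : ℕ} (g : Fin n → MvPolynomial (Fin n) B) :
    Derivation B (MvPolynomial (Fin n) B) (MvPolynomial (Fin n) B) :=
  MvPolynomial.mkDerivation B g

lemma lieDer_X {B : Type*} [CommRing B] {n : ℕ} (g : Fin n → MvPolynomial (Fin n) B) (i : Fin n) :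
    lieDer g (X i) = g i := mkDerivation_X _ _ _

/-- Substitution of the iterated Lie derivatives for the differential indeterminates. -/
def jetEval {B : Type*} [CommRing B] {n : ℕ} (g : Fin n → MvPolynomial (Fin n) B) :
    MvPolynomial (Fin n × ℕ) B →ₐ[B] MvPolynomial (Fin n) B :=
  aeval fun v => (lieDer g)^[v.2] (X v.1)

lemma jetEval_diffDer {B : Type*} [CommRing B] {n : ℕ} (g : Fin n → MvPolynomial (Fin n) B)
    (h : MvPolynomial (Fin n × ℕ) B) :
    jetEval g (diffDer B n h) = lieDer g (jetEval g h) := by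
  induction h using MvPolynomial.induction_on with
  | C a => simp [jetEval]
  | add p q hp hq => simp [hp, hq]
  | mul_X p i hp =>
    have h1 : diffDer B n (X i) = X (i.1, i.2 + 1) := mkDerivation_X _ _ _
    simp only [Derivation.leibniz, map_add, smul_eq_mul, map_mul, hp, h1]
    simp [jetEval, Function.iterate_succ_apply']

lemma jetEval_rename_zero {B : Type*} [CommRing B] {n : ℕ} (g : Fin n → MvPolynomial (Fin n) B)
    (q : MvPolynomial (Fin n) B) :
    jetEval g (rename (fun j => (j, 0)) q) = q := by
  rw [jetEval, aeval_rename]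
  exact aeval_X_left_apply q

lemma jetEval_iterate {B : Type*} [CommRing B] {n : ℕ} (g : Fin n → MvPolynomial (Fin n) B)
    (h : MvPolynomial (Fin n × ℕ) B) (j : ℕ) :
    jetEval g ((diffDer B n)^[j] h) = (lieDer g)^[j] (jetEval g h) := by
  induction j with
  | zero => rfl
  | succ j ih => rw [Function.iterate_succ_apply', Function.iterate_succ_apply', jetEval_diffDer, ih]

lemma iterate_lieDer_zero {B : Type*} [CommRing B] {n : ℕ} (g : Fin n → MvPolynomial (Fin n) B)
    (j : ℕ) : (lieDer g)^[j] 0 = 0 := by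
  induction j with
  | zero => rfl
  | succ j ih => rw [Function.iterate_succ_apply', ih, map_zero]

lemma diffDer_mem_sysIdeal {B : Type*} [CommRing B] {n : ℕ} {g : Fin n → MvPolynomial (Fin n) B}
    {h : MvPolynomial (Fin n × ℕ) B} (hh : h ∈ sysIdeal B n g) :
    diffDer B n h ∈ sysIdeal B n g := by
  unfold sysIdeal diffIdeal at *
  induction hh using Submodule.span_induction with
  | mem x hx =>
    obtain ⟨f, hf, j, rfl⟩ := hx
    exact Ideal.subset_span ⟨f, hf, j + 1, (Function.iterate_succ_apply' _ _ _).symm⟩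
  | zero => simp
  | add x y _ _ hx hy => rw [map_add]; exact add_mem hx hy
  | smul a x hx' hx =>
    rw [smul_eq_mul, Derivation.leibniz]
    exact add_mem (Ideal.mul_mem_left _ _ hx)
      (by rw [smul_eq_mul, mul_comm]; exact Ideal.mul_mem_left _ _ hx')

lemma mem_sysIdeal_iff {B : Type*} [CommRing B] {n : ℕ} (g : Fin n → MvPolynomial (Fin n) B)
    (h : MvPolynomial (Fin n × ℕ) B) : h ∈ sysIdeal B n g ↔ jetEval g h = 0 := by
  constructor
  · intro hh
    have : sysIdeal B n g ≤ RingHom.ker (jetEval g).toRingHom := by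
      unfold sysIdeal diffIdeal
      rw [Ideal.span_le]
      rintro _ ⟨_, ⟨i, rfl⟩, j, rfl⟩
      change jetEval g _ = 0
      rw [jetEval_iterate, map_sub, jetEval_rename_zero]
      have : jetEval g (X (i, 1)) = g i := by simp [jetEval, lieDer_X]
      rw [this, sub_self, iterate_lieDer_zero]
    exact this hh
  · intro hh
    have base : ∀ i, X (i, 1) - rename (fun j => (j, 0)) (g i) ∈ sysIdeal B n g := fun i =>
      Ideal.subset_span ⟨_, ⟨i, rfl⟩, 0, rfl⟩
    have hι : ∀ q : MvPolynomial (Fin n) B,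
        diffDer B n (rename (fun j => (j, 0)) q) - rename (fun j => (j, 0)) (lieDer g q)
          ∈ sysIdeal B n g := by
      intro q
      induction q using MvPolynomial.induction_on with
      | C a => simp
      | add p q hp hq =>
        simp only [map_add]
        convert add_mem hp hq using 1; ring
      | mul_X p i hp =>
        have h1 : diffDer B n (X (i, 0)) = X (i, 1) := mkDerivation_X _ _ _
        simp only [Derivation.leibniz, map_add, smul_eq_mul, map_mul, rename_X, h1, lieDer_X]
        convert add_mem (Ideal.mul_mem_left _ (rename (fun j => (j, 0)) p) (base i))
          (Ideal.mul_mem_left _ (X (i, 0)) hp) using 1; ring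
    have hX : ∀ (i : Fin n) (j : ℕ),
        X (i, j) - rename (fun j => (j, 0)) ((lieDer g)^[j] (X i)) ∈ sysIdeal B n g := by
      intro i j
      induction j with
      | zero => simp
      | succ j ih =>
        have h1 : diffDer B n (X (i, j)) = X (i, j + 1) := mkDerivation_X _ _ _
        have := add_mem (diffDer_mem_sysIdeal ih) (hι ((lieDer g)^[j] (X i)))
        rw [map_sub, h1, sub_add_sub_cancel] at this
        rwa [Function.iterate_succ_apply']
    have key : ∀ h : MvPolynomial (Fin n × ℕ) B,
        h - rename (fun j => (j, 0)) (jetEval g h) ∈ sysIdeal B n g := by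
      intro h
      induction h using MvPolynomial.induction_on with
      | C a => simp [jetEval]
      | add p q hp hq =>
        simp only [map_add]
        convert add_mem hp hq using 1; ring
      | mul_X p i hp =>
        have h2 : jetEval g (X i) = (lieDer g)^[i.2] (X i.1) := by simp [jetEval]
        simp only [map_mul, h2]
        convert add_mem (Ideal.mul_mem_left _ p (hX i.1 i.2))
          (Ideal.mul_mem_left _ (rename (fun j => (j, 0)) ((lieDer g)^[i.2] (X i.1))) hp) using 1
        ring
    simpa [hh] using key h

lemma exists_det_coeff_ne_zero {ι σ k : Type*} [Fintype ι] [DecidableEq ι] [Field k]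
    {v : ι → MvPolynomial σ k} (hv : LinearIndependent k v) :
    ∃ c : ι → σ →₀ ℕ, (Matrix.of fun i j => coeff (c j) (v i)).det ≠ 0 := by
  set col : (σ →₀ ℕ) → ι → k := fun m i => coeff m (v i) with hcol
  have hspan : Submodule.span k (Set.range col) = ⊤ := by
    by_contra hne
    obtain ⟨f, hf0, hf⟩ := Submodule.exists_le_ker_of_lt_top _ (lt_top_iff_ne_top.2 hne)
    apply hf0
    have hfa : ∀ x : ι → k, f x = ∑ i, x i * f (Pi.single i 1) := by
      intro x
      conv_lhs => rw [pi_eq_sum_univ' x]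
      simp [map_sum]
    have h0 : ∑ i, f (Pi.single i 1) • v i = 0 := by
      ext m
      have := hf (Submodule.subset_span ⟨m, rfl⟩)
      rw [LinearMap.mem_ker, hfa] at this
      simpa [coeff_sum, hcol, mul_comm] using this
    have := Fintype.linearIndependent_iff.1 hv _ h0
    ext i
    simp [this]
  obtain ⟨κ, a, -, hsp, hli⟩ := exists_linearIndependent' k col
  rw [hspan] at hsp
  let e : ι ≃ κ := (Pi.basisFun k ι).indexEquiv (Module.Basis.mk hli hsp.ge)
  refine ⟨a ∘ e, ?_⟩
  have h2 : LinearIndependent k (fun j => col (a (e j))) := hli.comp e e.injective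
  have h3 : IsUnit (Matrix.of fun j i => coeff (a (e j)) (v i)) :=
    Matrix.linearIndependent_rows_iff_isUnit.1 h2
  rw [Matrix.isUnit_iff_isUnit_det, ← Matrix.det_transpose] at h3
  exact h3.ne_zero

lemma linearIndependent_of_det_coeff_ne_zero {ι σ k : Type*} [Fintype ι] [DecidableEq ι] [Field k]
    {v : ι → MvPolynomial σ k} (c : ι → σ →₀ ℕ)
    (h : (Matrix.of fun i j => coeff (c j) (v i)).det ≠ 0) : LinearIndependent k v := by
  have h1 : LinearIndependent k (Matrix.of fun i j => coeff (c j) (v i)) :=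
    Matrix.linearIndependent_rows_iff_isUnit.2
      ((Matrix.isUnit_iff_isUnit_det _).2 (isUnit_iff_ne_zero.2 h))
  let L : MvPolynomial σ k →ₗ[k] (ι → k) := LinearMap.pi fun j => lcoeff k (c j)
  exact LinearIndependent.of_comp L h1


/-- The jets of the observed variable: the iterated Lie derivatives of `X 0`. -/
def jet {B : Type*} [CommRing B] {n : ℕ} [NeZero n] (g : Fin n → MvPolynomial (Fin n) B)
    (j : ℕ) : MvPolynomial (Fin n) B := (lieDer g)^[j] (X 0)

lemma jet_zero {B : Type*} [CommRing B] {n : ℕ} [NeZero n] (g : Fin n → MvPolynomial (Fin n) B) :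
    jet g 0 = X 0 := rfl

lemma jet_succ {B : Type*} [CommRing B] {n : ℕ} [NeZero n] (g : Fin n → MvPolynomial (Fin n) B)
    (j : ℕ) : jet g (j + 1) = lieDer g (jet g j) := Function.iterate_succ_apply' _ _ _

lemma map_lieDer {B B' : Type*} [CommRing B] [CommRing B'] {n : ℕ} (φ : B →+* B')
    (g : Fin n → MvPolynomial (Fin n) B) (q : MvPolynomial (Fin n) B) :
    map φ (lieDer g q) = lieDer (fun i => map φ (g i)) (map φ q) := by
  induction q using MvPolynomial.induction_on with
  | C a => simp [lieDer]
  | add p q hp hq => simp only [map_add, hp, hq]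
  | mul_X p i hp =>
    simp only [Derivation.leibniz, map_add, smul_eq_mul, map_mul, map_X, hp, lieDer_X]

lemma map_jet {B B' : Type*} [CommRing B] [CommRing B'] {n : ℕ} [NeZero n] (φ : B →+* B')
    (g : Fin n → MvPolynomial (Fin n) B) (j : ℕ) :
    map φ (jet g j) = jet (fun i => map φ (g i)) j := by
  induction j with
  | zero => simp [jet_zero]
  | succ j ih => rw [jet_succ, jet_succ, map_lieDer, ih]

/-- The degree bounds defining `V_{n,d} × V_{n,D}^{n-1}`. -/
def Adm {B : Type*} [CommRing B] {n : ℕ} [NeZero n] (d D : ℕ)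
    (g : Fin n → MvPolynomial (Fin n) B) : Prop :=
  ∀ i, (g i).totalDegree ≤ if i = 0 then d else D

/-- The weight of the `j`-th derivative. -/
def jetWt (d D j : ℕ) : ℕ := if j = 0 then 1 else d + (j - 1) * (D - 1)

lemma jetWt_zero (d D : ℕ) : jetWt d D 0 = 1 := rfl

lemma jetWt_succ (d D j : ℕ) : jetWt d D (j + 1) = d + j * (D - 1) := by simp [jetWt]

lemma jetWt_pos {d : ℕ} (hd : 0 < d) (D j : ℕ) : 0 < jetWt d D j := by
  unfold jetWt; split_ifs <;> omega

lemma totalDegree_lieDer_le {B : Type*} [CommRing B] {n D : ℕ} (hD : 0 < D)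
    {g : Fin n → MvPolynomial (Fin n) B} (hg : ∀ i, (g i).totalDegree ≤ D)
    (q : MvPolynomial (Fin n) B) : (lieDer g q).totalDegree ≤ q.totalDegree + (D - 1) := by
  conv_lhs => rw [q.as_sum, map_sum]
  refine totalDegree_finsetSum_le fun s hs => ?_
  rw [lieDer, mkDerivation_monomial, Finsupp.sum]
  refine (totalDegree_smul_le _ _).trans ?_
  refine totalDegree_finsetSum_le (fun i hi => ?_)
  rw [smul_eq_mul]
  refine (totalDegree_mul _ _).trans ?_
  have h1 : (monomial (s - Finsupp.single i 1) (s i : B)).totalDegree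
      ≤ (s - Finsupp.single i 1).degree := totalDegree_monomial_le _ _
  have h2 : s.degree ≤ q.totalDegree := le_totalDegree hs
  have h3 : (s - Finsupp.single i 1).degree + 1 = s.degree := by
    have : s - Finsupp.single i 1 + Finsupp.single i 1 = s := by
      refine tsub_add_cancel_of_le (Finsupp.single_le_iff.2 ?_)
      exact Nat.one_le_iff_ne_zero.2 (Finsupp.mem_support_iff.1 hi)
    conv_rhs => rw [← this]
    simp
  have := hg i
  omega

lemma totalDegree_jet_le {B : Type*} [CommRing B] {n d D : ℕ} [NeZero n] (hD : 0 < D)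
    (hdD : d ≤ D) {g : Fin n → MvPolynomial (Fin n) B} (hg : Adm d D g) (j : ℕ) :
    (jet g j).totalDegree ≤ jetWt d D j := by
  have hg' : ∀ i, (g i).totalDegree ≤ D := fun i => (hg i).trans (by split_ifs <;> omega)
  have h1 : ∀ j, (jet g (j + 1)).totalDegree ≤ d + j * (D - 1) := by
    intro j
    induction j with
    | zero =>
      rw [jet_succ, jet_zero, lieDer_X]
      simpa using hg 0
    | succ j ih =>
      rw [jet_succ]
      have := totalDegree_lieDer_le hD hg' (jet g (j + 1))
      rw [add_mul]; omega
  cases j with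
  | zero =>
    rw [jet_zero, jetWt_zero]
    exact (totalDegree_monomial_le (Finsupp.single 0 1) (1 : B)).trans (by simp)
  | succ j => rw [jetWt_succ]; exact h1 j

/-- Products of a monomial in the state variables with a monomial in the given polynomials. -/
def mixedMon {B : Type*} [CommRing B] {n : ℕ} (p : ℕ → MvPolynomial (Fin n) B)
    (be : (Fin n →₀ ℕ) × (Fin (n + 1) →₀ ℕ)) : MvPolynomial (Fin n) B :=
  monomial be.1 1 * ∏ j : Fin (n + 1), p j ^ be.2 j

lemma map_mixedMon {B B' : Type*} [CommRing B] [CommRing B'] {n : ℕ} (φ : B →+* B')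
    (p : ℕ → MvPolynomial (Fin n) B) (be : (Fin n →₀ ℕ) × (Fin (n + 1) →₀ ℕ)) :
    map φ (mixedMon p be) = mixedMon (fun j => map φ (p j)) be := by
  simp [mixedMon, map_prod]

lemma mixedMon_C_mul {B : Type*} [CommRing B] {n : ℕ} (a : ℕ → B)
    (p : ℕ → MvPolynomial (Fin n) B) (be : (Fin n →₀ ℕ) × (Fin (n + 1) →₀ ℕ)) :
    mixedMon (fun j => C (a j) * p j) be =
      C (∏ j : Fin (n + 1), a j ^ be.2 j) * mixedMon p be := by
  simp only [mixedMon, mul_pow, Finset.prod_mul_distrib, map_prod, map_pow]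
  ring

/-- The index set of the coefficients of a system. -/
abbrev CoeffIdx (n d D : ℕ) [NeZero n] : Type :=
  {p : Fin n × (Fin n →₀ ℕ) // ∑ j, p.2 j ≤ if p.1 = 0 then d else D}

open Classical in
/-- The system with indeterminate coefficients. -/
def genericSys (K : Type*) [CommRing K] (n d D : ℕ) [NeZero n] (i : Fin n) :
    MvPolynomial (Fin n) (MvPolynomial (CoeffIdx n d D) K) :=
  ∑ m ∈ (Finsupp.finite_of_degree_le (σ := Fin n) (max d D)).toFinset,
    if h : ∑ j, m j ≤ if i = 0 then d else D then monomial m (X ⟨(i, m), h⟩) else 0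

/-- The specialization of the indeterminate coefficients to those of `g`. -/
def spec (K : Type*) {B : Type*} [CommRing K] [CommRing B] [Algebra K B] {n : ℕ} (d D : ℕ)
    [NeZero n] (g : Fin n → MvPolynomial (Fin n) B) : MvPolynomial (CoeffIdx n d D) K →ₐ[K] B :=
  aeval fun p => coeff p.1.2 (g p.1.1)

lemma map_spec_genericSys {K B : Type*} [CommRing K] [CommRing B] [Algebra K B] {n d D : ℕ}
    [NeZero n] {g : Fin n → MvPolynomial (Fin n) B} (hg : Adm d D g) (i : Fin n) :
    map (spec K d D g : MvPolynomial (CoeffIdx n d D) K →+* B) (genericSys K n d D i) = g i := by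
  classical
  ext m
  have hdeg : ∀ m : Fin n →₀ ℕ, m.degree = ∑ j, m j := fun m => Finsupp.degree_eq_sum m
  rw [coeff_map, genericSys, coeff_sum, map_sum]
  rw [Finset.sum_eq_single m]
  · by_cases h : ∑ j, m j ≤ if i = 0 then d else D
    · rw [dif_pos h]; simp [spec]
    · rw [dif_neg h, coeff_zero, map_zero]
      symm
      by_contra h0
      have := le_totalDegree (mem_support_iff.2 h0)
      rw [Finsupp.sum_fintype _ _ (fun _ => rfl)] at this
      exact h (this.trans (hg i))
  · intro m' _ hne
    by_cases h : ∑ j, m' j ≤ if i = 0 then d else D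
    · rw [dif_pos h, coeff_monomial, if_neg hne, map_zero]
    · rw [dif_neg h, coeff_zero, map_zero]
  · intro hm
    rw [Set.Finite.mem_toFinset, Set.mem_ofPred_eq, hdeg] at hm
    rw [dif_neg, coeff_zero, map_zero]
    intro h
    apply hm
    refine h.trans ?_
    split_ifs <;> simp

/-- Linear independence of a finite family of mixed monomials in the jets is an open condition,
whose nonemptiness may be tested on a degeneration. -/
theorem exists_open_linearIndependent {K : Type*} [Field K] {n d D : ℕ} [NeZero n]
    {ι : Type*} [Fintype ι] (fam : ι → (Fin n →₀ ℕ) × (Fin (n + 1) →₀ ℕ))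
    {g : Fin n → MvPolynomial (Fin n) (Polynomial K)} (hg : Adm d D g) (E : ℕ → ℕ)
    (q : ℕ → MvPolynomial (Fin n) (Polynomial K))
    (hq : ∀ j ≤ n, jet g j = C (Polynomial.X ^ E j) * q j)
    (hli : LinearIndependent K fun i =>
      mixedMon (fun j => map (Polynomial.evalRingHom (0 : K)) (q j)) (fam i)) :
    ∃ P : MvPolynomial (CoeffIdx n d D) K, P ≠ 0 ∧
      ∀ g : Fin n → MvPolynomial (Fin n) K, Adm d D g → spec K d D g P ≠ 0 →
        LinearIndependent K fun i => mixedMon (jet g) (fam i) := by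
  classical
  obtain ⟨c, hc⟩ := exists_det_coeff_ne_zero hli
  set v := fun i => mixedMon (jet (genericSys K n d D)) (fam i) with hv
  refine ⟨(Matrix.of fun i j => coeff (c j) (v i)).det, ?_, ?_⟩
  · have hspec : ∀ i, map (spec K d D g : MvPolynomial (CoeffIdx n d D) K →+* Polynomial K) (v i) =
        C (∏ j : Fin (n + 1), (Polynomial.X ^ E j) ^ (fam i).2 j) * mixedMon q (fam i) := by
      intro i
      rw [hv, map_mixedMon, ← mixedMon_C_mul (fun j => Polynomial.X ^ E j)]
      simp only [mixedMon]
      congr 1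
      refine Finset.prod_congr rfl fun j _ => ?_
      rw [map_jet, funext (map_spec_genericSys hg), hq _ (by omega)]
    intro h0
    have h1 := congrArg (spec K d D g : MvPolynomial (CoeffIdx n d D) K →+* Polynomial K) h0
    rw [map_zero, RingHom.map_det] at h1
    have h2 : (RingHom.mapMatrix (spec K d D g : MvPolynomial (CoeffIdx n d D) K →+* Polynomial K)
        (Matrix.of fun i j => coeff (c j) (v i))) =
        Matrix.of fun i j => (∏ j : Fin (n + 1), (Polynomial.X ^ E j) ^ (fam i).2 j) *
          (Matrix.of fun i j => coeff (c j) (mixedMon q (fam i))) i j := by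
      ext1 i j
      simp only [RingHom.mapMatrix_apply, Matrix.map_apply, Matrix.of_apply]
      rw [← coeff_map, hspec, coeff_C_mul]
    rw [h2, Matrix.det_mul_column] at h1
    rcases mul_eq_zero.1 h1 with h3 | h3
    · rw [Finset.prod_eq_zero_iff] at h3
      obtain ⟨i, -, h3⟩ := h3
      rw [Finset.prod_eq_zero_iff] at h3
      obtain ⟨j, -, h3⟩ := h3
      exact pow_ne_zero _ (pow_ne_zero _ Polynomial.X_ne_zero) h3
    · apply hc
      have h4 := congrArg (Polynomial.evalRingHom (0 : K)) h3
      rw [map_zero, RingHom.map_det] at h4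
      refine Eq.trans ?_ h4
      congr 1
      ext i j
      simp only [RingHom.mapMatrix_apply, Matrix.map_apply, Matrix.of_apply]
      rw [← coeff_map, map_mixedMon]
  · intro g' hg' hne
    apply linearIndependent_of_det_coeff_ne_zero c
    intro h0
    apply hne
    rw [← h0]
    change (spec K d D g' : MvPolynomial (CoeffIdx n d D) K →+* K) _ = _
    rw [RingHom.map_det]
    congr 1
    ext i j
    simp only [RingHom.mapMatrix_apply, Matrix.map_apply, Matrix.of_apply]
    rw [← coeff_map, hv, map_mixedMon]
    congr 1
    simp only [mixedMon]
    congr 1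
    refine Finset.prod_congr rfl fun j _ => ?_
    rw [map_jet, funext (map_spec_genericSys hg')]

/-- The iterated images of `h` under `X ^ D * d/dX`. -/
def eulerIter {K : Type*} [CommRing K] (D : ℕ) (h : Polynomial K) : ℕ → Polynomial K
  | 0 => h
  | j + 1 => Polynomial.X ^ D * Polynomial.derivative (eulerIter D h j)

/-- A one-parameter family of systems, degenerating as the parameter tends to zero. -/
def degenSys {K : Type*} [CommRing K] {n : ℕ} [NeZero n] (D : ℕ) (h : Polynomial K)
    (m l : Fin n → ℕ) (i : Fin n) : MvPolynomial (Fin n) (Polynomial K) :=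
  if i = 0 then ∑ i, C (Polynomial.X ^ m i) * Polynomial.aeval (X i) h
  else C (Polynomial.X ^ l i) * X i ^ D

lemma lieDer_aeval_X {K : Type*} [CommRing K] {n : ℕ}
    (g : Fin n → MvPolynomial (Fin n) (Polynomial K)) (i : Fin n) (h : Polynomial K) :
    lieDer g (Polynomial.aeval (X i) h) =
      Polynomial.aeval (X i) (Polynomial.derivative h) * g i := by
  have := Derivation.map_aeval (D := (lieDer g).restrictScalars K) h (X i)
  rw [← lieDer_X g i]
  exact this

lemma lieDer_C_mul {B : Type*} [CommRing B] {n : ℕ} (g : Fin n → MvPolynomial (Fin n) B)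
    (a : B) (q : MvPolynomial (Fin n) B) : lieDer g (C a * q) = C a * lieDer g q := by
  rw [← smul_eq_C_mul, ← smul_eq_C_mul, (lieDer g).map_smul]

lemma jet_degenSys {K : Type*} [CommRing K] {n : ℕ} [NeZero n] (D : ℕ) (h : Polynomial K)
    (m l : Fin n → ℕ) (e : ℕ) (he : ∀ i, e ≤ m i) (j : ℕ) :
    ∃ T : MvPolynomial (Fin n) (Polynomial K),
      jet (degenSys D h m l) (j + 1) =
        ∑ i ∈ Finset.univ.erase 0, C (Polynomial.X ^ (m i + j * l i)) *
          Polynomial.aeval (X i) (eulerIter D h j) +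
        (if j = 0 then C (Polynomial.X ^ m 0) * Polynomial.aeval (X 0) h
          else C (Polynomial.X ^ (m 0 + e)) * T) := by
  have h0 : degenSys D h m l 0 = ∑ i, C (Polynomial.X ^ m i) * Polynomial.aeval (X i) h := if_pos rfl
  have hdvd : ∃ T, degenSys D h m l 0 = C (Polynomial.X ^ e) * T := by
    refine ⟨∑ i, C (Polynomial.X ^ (m i - e)) * Polynomial.aeval (X i) h, ?_⟩
    rw [h0, Finset.mul_sum]
    refine Finset.sum_congr rfl fun i _ => ?_
    rw [← mul_assoc, ← C_mul, ← pow_add, Nat.add_sub_cancel' (he i)]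
  have hmain : ∀ j, lieDer (degenSys D h m l)
      (∑ i ∈ Finset.univ.erase 0, C (Polynomial.X ^ (m i + j * l i)) *
          Polynomial.aeval (X i) (eulerIter D h j)) =
      ∑ i ∈ Finset.univ.erase 0, C (Polynomial.X ^ (m i + (j + 1) * l i)) *
          Polynomial.aeval (X i) (eulerIter D h (j + 1)) := by
    intro j
    rw [map_sum]
    refine Finset.sum_congr rfl fun i hi => ?_
    have hi0 : i ≠ 0 := Finset.ne_of_mem_erase hi
    rw [lieDer_C_mul, lieDer_aeval_X, degenSys, if_neg hi0, eulerIter]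
    simp only [map_mul, map_pow, Polynomial.aeval_X]
    ring
  induction j with
  | zero =>
    refine ⟨0, ?_⟩
    rw [jet_succ, jet_zero, lieDer_X, h0, if_pos rfl, ← Finset.add_sum_erase _ _ (Finset.mem_univ 0),
      add_comm]
    simp [eulerIter]
  | succ j ih =>
    obtain ⟨T, hT⟩ := ih
    rw [jet_succ, hT, map_add, hmain]
    rcases Nat.eq_zero_or_pos j with rfl | hj
    · obtain ⟨T', hT'⟩ := hdvd
      refine ⟨Polynomial.aeval (X 0) (Polynomial.derivative h) * T', ?_⟩
      rw [if_pos rfl, if_neg (by omega), lieDer_C_mul, lieDer_aeval_X, hT', pow_add, C_mul]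
      ring
    · refine ⟨lieDer (degenSys D h m l) T, ?_⟩
      rw [if_neg (by omega), if_neg (by omega), lieDer_C_mul]

lemma C_X_pow_mul_aeval_eq {K : Type*} [CommRing K] {σ : Type*} {a e : ℕ} (hle : e ≤ a)
    (f : MvPolynomial σ K) : ∃ q : MvPolynomial σ (Polynomial K),
      C (Polynomial.X ^ a) * map Polynomial.C f = C (Polynomial.X ^ e) * q ∧
      map (Polynomial.evalRingHom (0 : K)) q = if a = e then f else 0 := by
  refine ⟨C (Polynomial.X ^ (a - e)) * map Polynomial.C f, ?_, ?_⟩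
  · rw [← mul_assoc, ← C_mul, ← pow_add, Nat.add_sub_cancel' hle]
  · have h2 : map (Polynomial.evalRingHom (0 : K)) (map Polynomial.C f) = f := by
      have h3 : (Polynomial.evalRingHom (0 : K)).comp Polynomial.C = RingHom.id K := by
        ext; simp
      rw [map_map, h3, map_id]
    rw [map_mul, h2, map_C, Polynomial.coe_evalRingHom, Polynomial.eval_pow, Polynomial.eval_X]
    split_ifs with h
    · simp [h]
    · rw [zero_pow (by omega)]; simp

lemma jet_degenSys_limit {K : Type*} [CommRing K] {n : ℕ} [NeZero n] (D : ℕ) (h : Polynomial K)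
    (m l : Fin n → ℕ) (E : ℕ → ℕ) (hE : ∀ i, ∀ j < n, E (j + 1) ≤ m i + j * l i)
    (hE0 : ∀ j < n, j ≠ 0 → E (j + 1) < m 0 + E 1 ∧ E (j + 1) < m 0 + j * l 0)
    (j : ℕ) (hj : j < n) :
    ∃ q : MvPolynomial (Fin n) (Polynomial K),
      jet (degenSys D h m l) (j + 1) = C (Polynomial.X ^ E (j + 1)) * q ∧
      map (Polynomial.evalRingHom (0 : K)) q =
        ∑ i, if m i + j * l i = E (j + 1) then Polynomial.aeval (X i) (eulerIter D h j) else 0 := by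
  obtain ⟨T, hT⟩ := jet_degenSys D h m l (E 1)
    (fun i => by simpa using hE i 0 (Nat.pos_of_neZero n)) j
  have haev : ∀ (i : Fin n) (f : Polynomial K),
      (Polynomial.aeval (X i) f : MvPolynomial (Fin n) (Polynomial K)) =
        map Polynomial.C (Polynomial.aeval (X i) f) := by
    intro i f
    induction f using Polynomial.induction_on' with
    | add p q hp hq => rw [map_add, map_add, map_add, hp, hq]
    | monomial k a =>
      simp only [Polynomial.aeval_monomial, map_mul, map_pow, map_X]
      congr 1
      simp [MvPolynomial.algebraMap_apply]
  have h1 : ∀ i, ∃ q : MvPolynomial (Fin n) (Polynomial K),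
      C (Polynomial.X ^ (m i + j * l i)) * Polynomial.aeval (X i) (eulerIter D h j) =
        C (Polynomial.X ^ E (j + 1)) * q ∧ map (Polynomial.evalRingHom (0 : K)) q =
        if m i + j * l i = E (j + 1) then Polynomial.aeval (X i) (eulerIter D h j) else 0 := by
    intro i
    rw [haev]
    exact C_X_pow_mul_aeval_eq (hE i j hj) _
  choose q hq1 hq2 using h1
  by_cases hj0 : j = 0
  · subst hj0
    refine ⟨∑ i, q i, ?_, ?_⟩
    · rw [hT, if_pos rfl, add_comm, Finset.mul_sum, ← Finset.add_sum_erase _ _ (Finset.mem_univ 0)]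
      congr 1
      · rw [← hq1]; simp [eulerIter]
      · exact Finset.sum_congr rfl fun i _ => hq1 i
    · rw [map_sum]; exact Finset.sum_congr rfl fun i _ => hq2 i
  · obtain ⟨h3, h4⟩ := hE0 j hj hj0
    refine ⟨∑ i ∈ Finset.univ.erase 0, q i + C (Polynomial.X ^ (m 0 + E 1 - E (j + 1))) * T, ?_, ?_⟩
    · rw [hT, if_neg hj0, mul_add, Finset.mul_sum, ← mul_assoc, ← C_mul, ← pow_add,
        Nat.add_sub_cancel' h3.le]
      congr 1
      exact Finset.sum_congr rfl fun i _ => hq1 i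
    · rw [map_add, map_sum, ← Finset.add_sum_erase Finset.univ _ (Finset.mem_univ 0),
        if_neg h4.ne', zero_add, map_mul, map_C, Polynomial.coe_evalRingHom, Polynomial.eval_pow,
        Polynomial.eval_X, zero_pow (by omega), C_0, zero_mul, add_zero]
      exact Finset.sum_congr rfl fun i _ => hq2 i

lemma totalDegree_aeval_X_le {K B σ : Type*} [CommRing K] [CommRing B] [Algebra K B]
    (i : σ) (f : Polynomial K) :
    (Polynomial.aeval (X i : MvPolynomial σ B) f).totalDegree ≤ f.natDegree := by
  rw [Polynomial.aeval_eq_sum_range]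
  refine totalDegree_finsetSum_le fun k hk => ?_
  rw [algebra_compatible_smul B]
  refine (totalDegree_smul_le _ _).trans ?_
  rw [X_pow_eq_monomial]
  refine (totalDegree_monomial_le _ _).trans ?_
  simpa using Nat.lt_succ_iff.1 (Finset.mem_range.1 hk)

lemma adm_degenSys {K : Type*} [CommRing K] {n d : ℕ} [NeZero n] (D : ℕ) {h : Polynomial K}
    (hd : h.natDegree ≤ d) (m l : Fin n → ℕ) : Adm d D (degenSys D h m l) := by
  intro i
  have hC : ∀ (a : Polynomial K) (q : MvPolynomial (Fin n) (Polynomial K)),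
      (C a * q).totalDegree ≤ q.totalDegree := by
    intro a q
    rw [← smul_eq_C_mul]; exact totalDegree_smul_le _ _
  rw [degenSys]
  split_ifs with h0
  · refine totalDegree_finsetSum_le fun k _ => (hC _ _).trans ?_
    exact (totalDegree_aeval_X_le _ _).trans hd
  · refine (hC _ _).trans ?_
    rw [X_pow_eq_monomial]
    exact (totalDegree_monomial_le _ _).trans (by simp)

lemma exists_jet_degenSys_limit {K : Type*} [CommRing K] {n : ℕ} [NeZero n] (D : ℕ)
    (h : Polynomial K) (m l : Fin n → ℕ) (E : ℕ → ℕ) (hEz : E 0 = 0)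
    (hE : ∀ i, ∀ j < n, E (j + 1) ≤ m i + j * l i)
    (hE0 : ∀ j < n, j ≠ 0 → E (j + 1) < m 0 + E 1 ∧ E (j + 1) < m 0 + j * l 0) :
    ∃ q : ℕ → MvPolynomial (Fin n) (Polynomial K),
      (∀ j ≤ n, jet (degenSys D h m l) j = C (Polynomial.X ^ E j) * q j) ∧
      map (Polynomial.evalRingHom (0 : K)) (q 0) = X 0 ∧
      ∀ j < n, map (Polynomial.evalRingHom (0 : K)) (q (j + 1)) =
        ∑ i, if m i + j * l i = E (j + 1) then Polynomial.aeval (X i) (eulerIter D h j) else 0 := by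
  have h1 : ∀ j, ∃ q : MvPolynomial (Fin n) (Polynomial K), j < n →
      jet (degenSys D h m l) (j + 1) = C (Polynomial.X ^ E (j + 1)) * q ∧
      map (Polynomial.evalRingHom (0 : K)) q =
        ∑ i, if m i + j * l i = E (j + 1) then Polynomial.aeval (X i) (eulerIter D h j) else 0 := by
    intro j
    by_cases hj : j < n
    · obtain ⟨q, hq⟩ := jet_degenSys_limit D h m l E hE hE0 j hj
      exact ⟨q, fun _ => hq⟩
    · exact ⟨0, fun h => absurd h hj⟩
  choose q hq using h1
  refine ⟨fun j => Nat.casesOn j (X 0) q, ?_, by simp, fun j hj => (hq j hj).2⟩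
  intro j hj
  cases j with
  | zero => simp [jet_zero, hEz]
  | succ j => exact (hq j hj).1

lemma eulerIter_two_terms {K : Type*} [Field K] [CharZero K] {d D : ℕ} (hd : 0 < d) (hD : 0 < D)
    (b : K) (j : ℕ) : ∃ A B : K, A ≠ 0 ∧ (b = 0 → B = 0) ∧ (b ≠ 0 → 2 ≤ d → B ≠ 0) ∧
      eulerIter D (Polynomial.X ^ d + Polynomial.C b * Polynomial.X ^ (d - 1)) j =
        Polynomial.C A * Polynomial.X ^ jetWt d D (j + 1) +
          Polynomial.C B * Polynomial.X ^ (jetWt d D (j + 1) - 1) ∧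
      eulerIter D (Polynomial.X ^ d + Polynomial.C b * Polynomial.X ^ (d - 1)) (j + 1) =
        Polynomial.C ((jetWt d D (j + 1) : ℕ) * A) * Polynomial.X ^ (jetWt d D (j + 1) + (D - 1)) +
          Polynomial.C (((jetWt d D (j + 1) - 1 : ℕ) : K) * B) *
            Polynomial.X ^ (jetWt d D (j + 1) + (D - 1) - 1) := by
  have step : ∀ (r : ℕ) (A B : K), 0 < r → Polynomial.X ^ D * Polynomial.derivative
      (Polynomial.C A * Polynomial.X ^ r + Polynomial.C B * Polynomial.X ^ (r - 1)) =
      Polynomial.C (r * A) * Polynomial.X ^ (r + (D - 1)) +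
        Polynomial.C (((r - 1 : ℕ) : K) * B) * Polynomial.X ^ (r + (D - 1) - 1) := by
    intro r A B hr
    obtain ⟨r, rfl⟩ : ∃ r', r = r' + 1 := ⟨r - 1, by omega⟩
    obtain ⟨D, rfl⟩ : ∃ r', D = r' + 1 := ⟨D - 1, by omega⟩
    rcases Nat.eq_zero_or_pos r with rfl | hr'
    · simp only [zero_add, pow_one, Nat.sub_self, pow_zero, mul_one, Polynomial.derivative_add, Polynomial.derivative_C, Polynomial.derivative_C_mul, Polynomial.derivative_X, Nat.cast_zero, zero_mul, Nat.cast_one, one_mul, Polynomial.C_0, add_zero, Nat.add_sub_cancel]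
      ring
    · obtain ⟨r, rfl⟩ : ∃ r', r = r' + 1 := ⟨r - 1, by omega⟩
      simp only [Polynomial.derivative_add, Polynomial.derivative_C_mul_X_pow,
        Nat.add_sub_cancel, show r + 1 + 1 + D - 1 = r + 1 + D by omega, map_mul]
      ring
  have hw : ∀ j, 0 < jetWt d D (j + 1) := fun j => jetWt_pos hd D _
  induction j with
  | zero =>
    refine ⟨1, b, one_ne_zero, id, fun h _ => h, ?_, ?_⟩
    · simp [eulerIter, jetWt_succ]
    · have := step d 1 b hd
      simpa [eulerIter, jetWt_succ] using this
  | succ j ih =>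
    obtain ⟨A, B, hA, hB, hB', -, h2⟩ := ih
    have hw2 : jetWt d D (j + 1 + 1) = jetWt d D (j + 1) + (D - 1) := by
      rw [jetWt_succ, jetWt_succ]; ring
    refine ⟨jetWt d D (j + 1) * A, (jetWt d D (j + 1) - 1 : ℕ) * B, ?_, ?_, ?_, ?_, ?_⟩
    · exact mul_ne_zero (Nat.cast_ne_zero.2 (hw j).ne') hA
    · intro h; rw [hB h, mul_zero]
    · intro h h2
      refine mul_ne_zero (Nat.cast_ne_zero.2 ?_) (hB' h h2)
      rw [jetWt_succ]; omega
    · rw [h2, hw2]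
    · have := step _ (jetWt d D (j + 1) * A) ((jetWt d D (j + 1) - 1 : ℕ) * B) (hw (j + 1))
      rw [← this, eulerIter, h2, hw2]

lemma exists_strict_limit {K : Type*} [Field K] [CharZero K] {n d D : ℕ} [NeZero n] (hd : 0 < d)
    (hD : 0 < D) (k : Fin (n + 1)) :
    ∃ (g : Fin n → MvPolynomial (Fin n) (Polynomial K)) (E : ℕ → ℕ)
      (q : ℕ → MvPolynomial (Fin n) (Polynomial K)), Adm d D g ∧
      (∀ j ≤ n, jet g j = C (Polynomial.X ^ E j) * q j) ∧
      ∀ i : Fin n, ∃ c : K, c ≠ 0 ∧ map (Polynomial.evalRingHom (0 : K)) (q (k.succAbove i)) =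
        C c * X i ^ jetWt d D (k.succAbove i) := by
  set s : Fin n → ℕ := fun i => (k.succAbove i : ℕ) with hs
  have hsn : ∀ i, s i ≤ n := fun i => Nat.lt_succ_iff.1 (k.succAbove i).2
  have hsinj : Function.Injective s := Fin.val_injective.comp Fin.succAbove_right_injective
  have hs0 : s 0 ≤ 1 := by
    simp only [hs, Fin.succAbove]
    split_ifs
    · simp
    · simpa using Nat.mod_le 1 (n + 1)
  have hs1 : ∀ i, s i = 0 → i = 0 := by
    intro i hi
    simp only [hs, Fin.succAbove] at hi
    split_ifs at hi
    · ext; simpa using hi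
    · simp at hi
  set N := 2 * n ^ 2 + 2 * n + 5 with hN
  let m : Fin n → ℕ := fun i => N + s i ^ 2 + 1 - 2 * s i
  let l : Fin n → ℕ := fun i => 2 * (n - s i)
  let E : ℕ → ℕ := fun j => Nat.casesOn j 0 fun j => N + 2 * j * (n - 1) - j ^ 2
  have hn : 1 ≤ n := Nat.pos_of_neZero n
  have hm : ∀ i, (m i : ℤ) = N + ((s i : ℤ) - 1) ^ 2 := by
    intro i
    have := hsn i
    simp only [m]
    rw [Nat.cast_sub (by nlinarith)]
    push_cast; ring
  have hl : ∀ i, (l i : ℤ) = 2 * ((n : ℤ) - s i) := by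
    intro i
    have := hsn i
    simp only [l]
    push_cast [Nat.cast_sub this]; ring
  have hEc : ∀ j < n, (E (j + 1) : ℤ) = N + 2 * j * ((n : ℤ) - 1) - j ^ 2 := by
    intro j hj
    simp only [E]
    rw [Nat.cast_sub (by nlinarith)]
    push_cast [Nat.cast_sub hn]; ring
  have hgap : ∀ i, ∀ j < n, ((m i + j * l i : ℕ) : ℤ) = E (j + 1) + ((s i : ℤ) - (j + 1)) ^ 2 := by
    intro i j hj
    push_cast
    rw [hm, hl, hEc j hj]; ring
  have hE : ∀ i, ∀ j < n, E (j + 1) ≤ m i + j * l i := by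
    intro i j hj
    zify
    have := hgap i j hj
    push_cast at this
    nlinarith [sq_nonneg ((s i : ℤ) - (j + 1))]
  have hE0 : ∀ j < n, j ≠ 0 → E (j + 1) < m 0 + E 1 ∧ E (j + 1) < m 0 + j * l 0 := by
    intro j hj hj0
    constructor
    · zify
      have hE1 := hEc 0 hn
      rw [zero_add] at hE1
      rw [hEc j hj, hm, hE1]
      have : (j : ℤ) < n := by exact_mod_cast hj
      rw [hN]
      push_cast
      nlinarith [sq_nonneg ((s 0 : ℤ) - 1)]
    · zify
      have := hgap 0 j hj
      push_cast at this
      rw [this]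
      have h1 : (s 0 : ℤ) ≤ 1 := by exact_mod_cast hs0
      have h2 : (1 : ℤ) ≤ j := by exact_mod_cast Nat.one_le_iff_ne_zero.2 hj0
      nlinarith
  obtain ⟨q, hq1, hq2, hq3⟩ := exists_jet_degenSys_limit D
    (Polynomial.X ^ d + Polynomial.C (0 : K) * Polynomial.X ^ (d - 1)) m l E rfl hE hE0
  refine ⟨_, E, q, adm_degenSys D (by simp) m l, hq1, fun i => ?_⟩
  rcases Nat.eq_zero_or_pos (s i) with h0 | h0
  · refine ⟨1, one_ne_zero, ?_⟩
    change map _ (q (s i)) = C 1 * X i ^ jetWt d D (s i)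
    rw [h0, hq2, hs1 i h0]; simp [jetWt]
  · obtain ⟨j, hj⟩ : ∃ j, s i = j + 1 := ⟨s i - 1, by omega⟩
    have hjn : j < n := by have := hsn i; omega
    obtain ⟨A, B, hA, hB, -, h1, -⟩ := eulerIter_two_terms hd hD (0 : K) j
    refine ⟨A, hA, ?_⟩
    change map _ (q (s i)) = C A * X i ^ jetWt d D (s i)
    rw [hj, hq3 j hjn, Finset.sum_eq_single i, if_pos, h1, hB rfl]
    · simp [MvPolynomial.algebraMap_eq]
    · have := hgap i j hjn
      rw [hj] at this
      push_cast at this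
      simp only [sub_self] at this
      zify; linarith
    · intro i' _ hne
      rw [if_neg]
      intro h
      have h2 := hgap i' j hjn
      rw [h] at h2
      have h3 : ((s i' : ℤ) - (j + 1)) ^ 2 = 0 := by linarith
      have h4 := pow_eq_zero_iff (two_ne_zero) |>.1 h3
      exact hne (hsinj (by omega))
    · simp

lemma exists_tie_limit {K : Type*} [Field K] {n : ℕ} [NeZero n] (d D : ℕ) (b : K) :
    ∃ (g : Fin n → MvPolynomial (Fin n) (Polynomial K)) (E : ℕ → ℕ)
      (q : ℕ → MvPolynomial (Fin n) (Polynomial K)), Adm d D g ∧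
      (∀ j ≤ n, jet g j = C (Polynomial.X ^ E j) * q j) ∧
      map (Polynomial.evalRingHom (0 : K)) (q 0) = X 0 ∧
      ∀ j < n, map (Polynomial.evalRingHom (0 : K)) (q (j + 1)) =
        ∑ i : Fin n, if (i : ℕ) = j ∨ (i : ℕ) = j + 1 then Polynomial.aeval (X i)
          (eulerIter D (Polynomial.X ^ d + Polynomial.C b * Polynomial.X ^ (d - 1)) j) else 0 := by
  set N := 2 * n ^ 2 + 2 * n + 5 with hN
  let m : Fin n → ℕ := fun i => N + (i : ℕ) ^ 2 - i
  let l : Fin n → ℕ := fun i => 2 * (n - (i + 1))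
  let E : ℕ → ℕ := fun j => Nat.casesOn j 0 fun j => N + 2 * j * n - (j ^ 2 + 3 * j)
  have hn : 1 ≤ n := Nat.pos_of_neZero n
  have hm : ∀ i, (m i : ℤ) = N + (i : ℤ) ^ 2 - i := by
    intro i
    have := i.2
    simp only [m]
    rw [Nat.cast_sub (by nlinarith)]
    push_cast; ring
  have hl : ∀ i, (l i : ℤ) = 2 * ((n : ℤ) - (i + 1)) := by
    intro i
    have := i.2
    simp only [l]
    push_cast [Nat.cast_sub (show (i : ℕ) + 1 ≤ n by omega)]; ring
  have hEc : ∀ j < n, (E (j + 1) : ℤ) = N + 2 * j * n - j ^ 2 - 3 * j := by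
    intro j hj
    simp only [E]
    rw [Nat.cast_sub (by nlinarith)]
    push_cast; ring
  have hgap : ∀ i, ∀ j < n, ((m i + j * l i : ℕ) : ℤ) =
      E (j + 1) + ((i : ℤ) - j) * ((i : ℤ) - j - 1) := by
    intro i j hj
    push_cast
    rw [hm, hl, hEc j hj]; ring
  have hpos : ∀ a : ℤ, 0 ≤ a * (a - 1) := by
    intro a
    rcases le_or_gt a 0 with h | h <;> nlinarith
  have hE : ∀ i, ∀ j < n, E (j + 1) ≤ m i + j * l i := by
    intro i j hj
    zify
    have := hgap i j hj
    push_cast at this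
    linarith [hpos ((i : ℤ) - j)]
  have hE0 : ∀ j < n, j ≠ 0 → E (j + 1) < m 0 + E 1 ∧ E (j + 1) < m 0 + j * l 0 := by
    intro j hj hj0
    have h2 : (1 : ℤ) ≤ j := by exact_mod_cast Nat.one_le_iff_ne_zero.2 hj0
    constructor
    · zify
      have hE1 := hEc 0 hn
      rw [zero_add] at hE1
      rw [hEc j hj, hm, hE1]
      have : (j : ℤ) < n := by exact_mod_cast hj
      rw [hN]
      push_cast
      simp only [Fin.val_zero]
      push_cast
      nlinarith
    · zify
      have := hgap 0 j hj
      push_cast at this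
      rw [this]
      simp only [Fin.val_zero]
      push_cast
      nlinarith
  obtain ⟨q, hq1, hq2, hq3⟩ := exists_jet_degenSys_limit D
    (Polynomial.X ^ d + Polynomial.C b * Polynomial.X ^ (d - 1)) m l E rfl hE hE0
  refine ⟨_, E, q, adm_degenSys D ?_ m l, hq1, hq2, fun j hj => ?_⟩
  · refine (Polynomial.natDegree_add_le _ _).trans (max_le (by simp) ?_)
    exact (Polynomial.natDegree_C_mul_X_pow_le _ _).trans (Nat.sub_le _ _)
  rw [hq3 j hj]
  refine Finset.sum_congr rfl fun i _ => ?_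
  refine if_congr ?_ rfl rfl
  have h1 := hgap i j hj
  constructor
  · intro h
    rw [h] at h1
    have h3 : ((i : ℤ) - j) * ((i : ℤ) - j - 1) = 0 := by linarith
    rcases mul_eq_zero.1 h3 with h4 | h4
    · left; omega
    · right; omega
  · intro h
    have h3 : ((i : ℤ) - j) * ((i : ℤ) - j - 1) = 0 := by
      rcases h with h | h <;> rw [h] <;> push_cast <;> ring
    rw [h3, add_zero] at h1
    exact_mod_cast h1

/-- The mixed monomial attached to `γ` by division with remainder by the weights of the jets
other than the `k`-th one. -/
def stairIdx {n : ℕ} (d D : ℕ) (k : Fin (n + 1)) (γ : Fin n →₀ ℕ) :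
    (Fin n →₀ ℕ) × (Fin (n + 1) →₀ ℕ) :=
  (Finsupp.equivFunOnFinite.symm fun i => γ i % jetWt d D (k.succAbove i),
    Finsupp.equivFunOnFinite.symm
      (k.insertNth 0 fun i => γ i / jetWt d D (k.succAbove i) : Fin (n + 1) → ℕ))

lemma mixedMon_stairIdx {B : Type*} [CommRing B] {n : ℕ} (d D : ℕ) (k : Fin (n + 1))
    (γ : Fin n →₀ ℕ) (p : ℕ → MvPolynomial (Fin n) B) :
    mixedMon p (stairIdx d D k γ) = (∏ i, X i ^ (γ i % jetWt d D (k.succAbove i))) *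
      ∏ i, p (k.succAbove i) ^ (γ i / jetWt d D (k.succAbove i)) := by
  rw [mixedMon, Fin.prod_univ_succAbove _ k]
  simp [stairIdx, monomial_eq, Finsupp.prod_fintype]

instance (n M : ℕ) : Finite {γ : Fin n →₀ ℕ // γ.degree ≤ M} :=
  (Finsupp.finite_of_degree_le M).to_subtype

lemma exists_open_stair {K : Type*} [Field K] [CharZero K] {n d D : ℕ} [NeZero n] (hd : 0 < d)
    (hD : 0 < D) (k : Fin (n + 1)) (M : ℕ) :
    ∃ P : MvPolynomial (CoeffIdx n d D) K, P ≠ 0 ∧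
      ∀ g : Fin n → MvPolynomial (Fin n) K, Adm d D g → spec K d D g P ≠ 0 →
        LinearIndependent K fun γ : {γ : Fin n →₀ ℕ // γ.degree ≤ M} =>
          mixedMon (jet g) (stairIdx d D k γ.1) := by
  have := Fintype.ofFinite {γ : Fin n →₀ ℕ // γ.degree ≤ M}
  obtain ⟨g, E, q, hg, hq, hlim⟩ := exists_strict_limit (K := K) (n := n) hd hD k
  refine exists_open_linearIndependent
    (fun γ : {γ : Fin n →₀ ℕ // γ.degree ≤ M} => stairIdx d D k γ.1) hg E q hq ?_
  choose c hc hcq using hlim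
  have h1 : ∀ γ : Fin n →₀ ℕ,
      mixedMon (fun j => map (Polynomial.evalRingHom (0 : K)) (q j)) (stairIdx d D k γ) =
      monomial γ (∏ i, c i ^ (γ i / jetWt d D (k.succAbove i))) := by
    intro γ
    rw [mixedMon_stairIdx]
    simp only [hcq, mul_pow, Finset.prod_mul_distrib]
    rw [mul_left_comm, ← Finset.prod_mul_distrib, monomial_eq, Finsupp.prod_fintype _ _ (by simp),
      map_prod]
    congr 1
    · simp
    · refine Finset.prod_congr rfl fun i _ => ?_
      rw [← pow_mul, ← pow_add, Nat.mod_add_div]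
  simp only [h1]
  rw [Fintype.linearIndependent_iff]
  intro a ha γ
  have h2 := congrArg (coeff γ.1) ha
  rw [coeff_sum, Finset.sum_eq_single γ, coeff_smul, coeff_monomial, if_pos rfl, coeff_zero] at h2
  · refine (mul_eq_zero.1 h2).resolve_right (Finset.prod_ne_zero_iff.2 fun i _ => ?_)
    exact pow_ne_zero _ (hc i)
  · intro γ' _ hne
    rw [coeff_smul, coeff_monomial, if_neg, smul_zero]
    exact fun h => hne (Subtype.ext h)
  · simp

/-- All exponents of `f` have weight at most `b`. -/
def WtLE {τ R : Type*} [CommRing R] (w : τ → ℕ) (b : ℤ) (f : MvPolynomial τ R) : Prop :=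
  ∀ e ∈ f.support, (Finsupp.weight w e : ℤ) ≤ b

namespace WtLE

variable {τ R : Type*} [CommRing R] {w : τ → ℕ} {a b : ℤ} {f g : MvPolynomial τ R}

lemma zero : WtLE w b (0 : MvPolynomial τ R) := by simp [WtLE]

lemma monomial {e : τ →₀ ℕ} (r : R) (h : (Finsupp.weight w e : ℤ) ≤ b) :
    WtLE w b (monomial e r) := by
  intro e' he'
  rwa [Finset.mem_singleton.1 (support_monomial_subset he')]

lemma add (hf : WtLE w b f) (hg : WtLE w b g) : WtLE w b (f + g) := by
  classical
  intro e he
  rcases Finset.mem_union.1 (support_add he) with h | h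
  exacts [hf e h, hg e h]

lemma mul (hf : WtLE w a f) (hg : WtLE w b g) : WtLE w (a + b) (f * g) := by
  classical
  intro e he
  obtain ⟨x, hx, y, hy, rfl⟩ := Finset.mem_add.1 (support_mul f g he)
  rw [map_add]
  push_cast
  exact add_le_add (hf x hx) (hg y hy)

lemma C (r : R) (hb : 0 ≤ b) : WtLE w b (C r : MvPolynomial τ R) :=
  monomial r (by simpa using hb)

lemma X (i : τ) (hb : (w i : ℤ) ≤ b) : WtLE w b (X i : MvPolynomial τ R) :=
  monomial 1 (by simpa [Finsupp.weight_single] using hb)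

lemma neg (hf : WtLE w b f) : WtLE w b (-f) := by
  intro e he
  rw [support_neg] at he
  exact hf e he

lemma sub (hf : WtLE w b f) (hg : WtLE w b g) : WtLE w b (f - g) := by
  rw [sub_eq_add_neg]; exact hf.add hg.neg

lemma sum {ι : Type*} (s : Finset ι) (F : ι → MvPolynomial τ R) (h : ∀ i ∈ s, WtLE w b (F i)) :
    WtLE w b (∑ i ∈ s, F i) :=
  Finset.sum_induction F (WtLE w b) (fun _ _ => add) zero h

lemma prod {ι : Type*} (s : Finset ι) (F : ι → MvPolynomial τ R) (c : ι → ℤ)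
    (h : ∀ i ∈ s, WtLE w (c i) (F i)) : WtLE w (∑ i ∈ s, c i) (∏ i ∈ s, F i) := by
  classical
  induction s using Finset.induction_on with
  | empty =>
    rw [Finset.sum_empty, Finset.prod_empty, ← C_1]
    exact C 1 le_rfl
  | insert i s hi ih =>
    rw [Finset.sum_insert hi, Finset.prod_insert hi]
    exact (h i (Finset.mem_insert_self _ _)).mul
      (ih fun j hj => h j (Finset.mem_insert_of_mem hj))

lemma rename {τ' : Type*} {w' : τ' → ℕ} {s : τ → τ'} (hs : ∀ i, w' (s i) = w i)
    (hf : WtLE w b f) : WtLE w' b (rename s f) := by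
  intro e he
  obtain ⟨e', rfl, he'⟩ := coeff_rename_ne_zero s f e (mem_support_iff.1 he)
  rw [show Finsupp.weight w' (Finsupp.mapDomain s e') = Finsupp.weight w e' by
    simp [Finsupp.weight_apply, Finsupp.sum_mapDomain_index, add_mul, hs]]
  exact hf e' (mem_support_iff.2 he')

lemma det {ι : Type*} [Fintype ι] [DecidableEq ι] (M : Matrix ι ι (MvPolynomial τ R)) (c : ι → ℤ)
    (b : ℤ) (h : ∀ i j, WtLE w (b + c i - c j) (M i j)) : WtLE w (Fintype.card ι * b) M.det := by
  rw [Matrix.det_apply]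
  refine sum _ _ fun σ _ => ?_
  have h1 := prod (w := w) Finset.univ (fun i => M (σ i) i) _ (fun i _ => h (σ i) i)
  have h2 : ∑ i, (b + c (σ i) - c i) = Fintype.card ι * b := by
    rw [Finset.sum_sub_distrib, Finset.sum_add_distrib, Equiv.sum_comp σ c]
    simp
  rw [h2] at h1
  rcases Int.units_eq_one_or (Equiv.Perm.sign σ) with hσ | hσ <;> rw [hσ]
  · simpa using h1
  · simpa using h1.neg

end WtLE

lemma coeff_aeval_pi_single {τ R : Type*} [CommRing R] [DecidableEq τ] (k : τ)
    (F : MvPolynomial τ R) (N : ℕ) :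
    (aeval (Pi.single k (Polynomial.X : Polynomial R)) F).coeff N =
      coeff (Finsupp.single k N) F := by
  induction F using MvPolynomial.monomial_add_induction_on with
  | C a =>
    rw [MvPolynomial.aeval_C, coeff_C]
    simp [Polynomial.coeff_C, eq_comm]
  | monomial_add e a F he ha ih =>
    rw [map_add, Polynomial.coeff_add, coeff_add, ih, aeval_monomial, coeff_monomial]
    congr 1
    by_cases hek : ∃ N', e = Finsupp.single k N'
    · obtain ⟨N', rfl⟩ := hek
      have h1 : Finsupp.single k N' = Finsupp.single k N ↔ N = N' :=
        (Finsupp.single_injective k).eq_iff.trans eq_comm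
      simp only [h1]
      simp [Polynomial.coeff_X_pow]
    · rw [if_neg fun h => hek ⟨N, h⟩]
      obtain ⟨j, hj, hjk⟩ : ∃ j ∈ e.support, j ≠ k := by
        by_contra! h
        apply hek
        refine ⟨e k, ?_⟩
        ext j
        by_cases hj : j = k
        · simp [hj]
        · rw [Finsupp.single_eq_of_ne hj]
          by_contra h0
          exact hj (h j (Finsupp.mem_support_iff.2 h0))
      rw [Finsupp.prod, Finset.prod_eq_zero hj, mul_zero, Polynomial.coeff_zero]
      rw [Pi.single_eq_of_ne hjk, zero_pow (Finsupp.mem_support_iff.1 hj)]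

/-- The staircase of exponents below the weights of the jets other than the `k`-th one. -/
abbrev StairBox {n : ℕ} (d D : ℕ) (k : Fin (n + 1)) : Type :=
  (i : Fin n) → Fin (jetWt d D (k.succAbove i))

/-- The monomial with exponent in the staircase. -/
def boxMon (K : Type*) [CommRing K] {n d D : ℕ} {k : Fin (n + 1)} (β : StairBox d D k) :
    MvPolynomial (Fin n) K := ∏ i, X i ^ (β i : ℕ)

lemma totalDegree_boxMon_le {K : Type*} [Field K] {n d D : ℕ} {k : Fin (n + 1)}
    (β : StairBox d D k) : (boxMon K β).totalDegree ≤ ∑ i, (β i : ℕ) := by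
  refine (totalDegree_finsetProd _ _).trans (Finset.sum_le_sum fun i _ => ?_)
  exact (totalDegree_pow _ _).trans (by rw [totalDegree_X, mul_one])

lemma totalDegree_mixedMon_stairIdx_le {K : Type*} [Field K] {n d D : ℕ} {k : Fin (n + 1)}
    {p : ℕ → MvPolynomial (Fin n) K} (hp : ∀ j ≤ n, (p j).totalDegree ≤ jetWt d D j)
    (γ : Fin n →₀ ℕ) : (mixedMon p (stairIdx d D k γ)).totalDegree ≤ γ.degree := by
  rw [mixedMon_stairIdx, Finsupp.degree_eq_sum, ← Finset.prod_mul_distrib]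
  refine (totalDegree_finsetProd _ _).trans (Finset.sum_le_sum fun i _ => ?_)
  refine (totalDegree_mul _ _).trans ?_
  have h1 := (totalDegree_pow (X i : MvPolynomial (Fin n) K)
    (γ i % jetWt d D (k.succAbove i)))
  have h2 := (totalDegree_pow (p (k.succAbove i)) (γ i / jetWt d D (k.succAbove i)))
  rw [totalDegree_X, mul_one] at h1
  have h3 := hp (k.succAbove i) (by omega)
  calc _ ≤ γ i % jetWt d D (k.succAbove i) +
      γ i / jetWt d D (k.succAbove i) * jetWt d D (k.succAbove i) :=
        add_le_add h1 (h2.trans (Nat.mul_le_mul_left _ h3))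
    _ = γ i := by rw [mul_comm]; exact Nat.mod_add_div _ _

lemma exists_stair_expansion {K : Type*} [Field K] {n d D : ℕ} (hd : 0 < d) {k : Fin (n + 1)}
    {p : ℕ → MvPolynomial (Fin n) K} (hp : ∀ j ≤ n, (p j).totalDegree ≤ jetWt d D j) {M : ℕ}
    (hli : LinearIndependent K fun γ : {γ : Fin n →₀ ℕ // γ.degree ≤ M} =>
      mixedMon p (stairIdx d D k γ.1))
    {M' : ℕ} (hM' : M' ≤ M) {q : MvPolynomial (Fin n) K} (hq : q.totalDegree ≤ M') :
    ∃ c : StairBox d D k → MvPolynomial (Fin n) K,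
      (∀ β, WtLE (fun i => jetWt d D (k.succAbove i)) (M' - ∑ i, ((β i : ℕ) : ℤ)) (c β)) ∧
      q = ∑ β, boxMon K β * aeval (fun i => p (k.succAbove i)) (c β) := by
  classical
  have := Fintype.ofFinite {γ : Fin n →₀ ℕ // γ.degree ≤ M'}
  let v : {γ : Fin n →₀ ℕ // γ.degree ≤ M'} → restrictTotalDegree (Fin n) K M' := fun γ =>
    ⟨mixedMon p (stairIdx d D k γ.1), (mem_restrictTotalDegree _ _ _).2
      ((totalDegree_mixedMon_stairIdx_le hp _).trans γ.2)⟩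
  have hv : LinearIndependent K v := by
    refine LinearIndependent.of_comp (Submodule.subtype _) ?_
    exact hli.comp (fun γ : {γ : Fin n →₀ ℕ // γ.degree ≤ M'} =>
      (⟨γ.1, γ.2.trans hM'⟩ : {γ : Fin n →₀ ℕ // γ.degree ≤ M}))
      fun a b h => Subtype.ext (congrArg (fun z => z.1) h)
  have hspan := hv.span_eq_top_of_card_eq_finrank' (by
    let b : Module.Basis {γ : Fin n →₀ ℕ // γ.degree ≤ M'} K (restrictTotalDegree (Fin n) K M') :=
      basisRestrictSupport K {γ : Fin n →₀ ℕ | (γ.sum fun _ e => e) ≤ M'}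
    exact (Module.finrank_eq_card_basis b).symm)
  have hqmem : (⟨q, (mem_restrictTotalDegree _ _ _).2 hq⟩ : restrictTotalDegree (Fin n) K M') ∈
      Submodule.span K (Set.range v) := hspan ▸ Submodule.mem_top
  obtain ⟨a, ha⟩ := Submodule.mem_span_range_iff_exists_fun K |>.1 hqmem
  have ha' : ∑ γ, a γ • mixedMon p (stairIdx d D k γ.1) = q := by
    simpa [v] using congrArg (Submodule.subtype _) ha
  have hw : ∀ i : Fin n, 0 < jetWt d D (k.succAbove i) := fun i => jetWt_pos hd D _
  let r : (Fin n →₀ ℕ) → StairBox d D k := fun γ i => ⟨γ i % _, Nat.mod_lt _ (hw i)⟩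
  let e : (Fin n →₀ ℕ) → (Fin n →₀ ℕ) := fun γ =>
    Finsupp.equivFunOnFinite.symm fun i => γ i / jetWt d D (k.succAbove i)
  refine ⟨fun β => ∑ γ : {γ : Fin n →₀ ℕ // γ.degree ≤ M'},
    if r γ.1 = β then monomial (e γ.1) (a γ) else 0, fun β => ?_, ?_⟩
  · refine WtLE.sum _ _ fun γ _ => ?_
    split_ifs with h
    · refine WtLE.monomial _ ?_
      subst h
      have h2 := γ.2
      rw [Finsupp.degree_eq_sum] at h2
      have h3 : Finsupp.weight (fun i => jetWt d D (k.succAbove i)) (e γ.1) +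
          ∑ i, ((r γ.1 i : ℕ)) = ∑ i, γ.1 i := by
        rw [Finsupp.weight_apply, Finsupp.sum_fintype _ _ (by simp), ← Finset.sum_add_distrib]
        refine Finset.sum_congr rfl fun i _ => ?_
        simp only [e, r, Finsupp.equivFunOnFinite_symm_apply_apply, smul_eq_mul]
        rw [mul_comm]; exact Nat.div_add_mod _ _
      rw [← h3] at h2
      zify at h2
      linarith
    · exact WtLE.zero
  · rw [← ha']
    simp only [map_sum, Finset.mul_sum]
    rw [Finset.sum_comm]
    refine Finset.sum_congr rfl fun γ _ => ?_
    rw [Finset.sum_eq_single (r γ.1)]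
    · rw [if_pos rfl, aeval_monomial, mixedMon_stairIdx, Finsupp.prod_fintype _ _ (by simp),
        Algebra.smul_def, boxMon]
      simp only [e, r, Finsupp.equivFunOnFinite_symm_apply_apply]
      ring
    · intro β _ hne
      rw [if_neg hne.symm, map_zero, mul_zero]
    · simp

lemma exists_relation {K : Type*} [Field K] {n d D : ℕ} (hd : 0 < d) {k : Fin (n + 1)}
    {p : ℕ → MvPolynomial (Fin n) K} (hp : ∀ j ≤ n, (p j).totalDegree ≤ jetWt d D j) {M : ℕ}
    (hli : LinearIndependent K fun γ : {γ : Fin n →₀ ℕ // γ.degree ≤ M} =>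
      mixedMon p (stairIdx d D k γ.1)) (hM : ∑ j : Fin (n + 1), jetWt d D j ≤ M) :
    ∃ F : MvPolynomial (Fin (n + 1)) K, aeval (fun j : Fin (n + 1) => p j) F = 0 ∧
      WtLE (fun j : Fin (n + 1) => jetWt d D j) (∏ j : Fin (n + 1), jetWt d D j : ℕ) F ∧
      coeff (Finsupp.single k (∏ i : Fin n, jetWt d D (k.succAbove i))) F = 1 := by
  classical
  have hw : ∀ i : Fin n, 0 < jetWt d D (k.succAbove i) := fun i => jetWt_pos hd D _
  have hbox : ∀ β : StairBox d D k, ∑ i, (β i : ℕ) ≤ ∑ i : Fin n, jetWt d D (k.succAbove i) :=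
    fun β => Finset.sum_le_sum fun i _ => (β i).2.le
  rw [Fin.sum_univ_succAbove _ k] at hM
  have hdeg : ∀ α : StairBox d D k,
      (p k * boxMon K α).totalDegree ≤ jetWt d D k + ∑ i, (α i : ℕ) := fun α =>
    (totalDegree_mul _ _).trans (add_le_add (hp k (by omega)) (totalDegree_boxMon_le α))
  choose c hc1 hc2 using fun α : StairBox d D k => exists_stair_expansion hd hp hli
    ((Nat.add_le_add_left (hbox α) _).trans hM) (hdeg α)
  let M0 : Matrix (StairBox d D k) (StairBox d D k) (MvPolynomial (Fin (n + 1)) K) :=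
    Matrix.scalar _ (X k) - Matrix.of fun α β => rename k.succAbove (c α β)
  have hM0 : ∀ α β, M0 α β = (if α = β then X k else 0) - rename k.succAbove (c α β) := by
    intro α β
    simp [M0, Matrix.diagonal_apply]
  refine ⟨M0.det, ?_, ?_, ?_⟩
  · rw [AlgHom.map_det, ← Matrix.exists_mulVec_eq_zero_iff]
    refine ⟨boxMon K, ?_, ?_⟩
    · intro h0
      have := congrFun h0 fun i => ⟨0, hw i⟩
      simp [boxMon] at this
    · ext1 α
      simp only [Matrix.mulVec, dotProduct, AlgHom.mapMatrix_apply, Matrix.map_apply, hM0,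
        map_sub, sub_mul, Finset.sum_sub_distrib, Pi.zero_apply, aeval_rename]
      rw [sub_eq_zero]
      trans p k * boxMon K α
      · rw [Finset.sum_eq_single α]
        · simp
        · intro β _ hne
          rw [if_neg hne.symm, map_zero, zero_mul]
        · simp
      · rw [hc2 α]
        refine Finset.sum_congr rfl fun β _ => ?_
        rw [mul_comm]; rfl
  · have := WtLE.det (w := fun j : Fin (n + 1) => jetWt d D j) M0
      (fun α => ∑ i, ((α i : ℕ) : ℤ)) (jetWt d D k) fun α β => by
        rw [hM0]
        refine WtLE.sub ?_ ?_
        · split_ifs with h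
          · subst h
            exact WtLE.X k (by simp)
          · exact WtLE.zero
        · have := WtLE.rename (w' := fun j : Fin (n + 1) => jetWt d D j) (s := k.succAbove)
            (fun i => rfl) (hc1 α β)
          push_cast at this
          exact this
    convert this using 1
    rw [Fin.prod_univ_succAbove _ k, Fintype.card_pi]
    simp [mul_comm]
  · rw [← coeff_aeval_pi_single]
    rw [AlgHom.map_det]
    have h1 : AlgHom.mapMatrix (aeval (R := K) (Pi.single k (Polynomial.X : Polynomial K))) M0 =
        (Matrix.of fun α β => constantCoeff (c α β)).charmatrix := by
      ext1 α β
      rw [AlgHom.mapMatrix_apply, Matrix.map_apply, hM0, Matrix.charmatrix_apply,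
        Matrix.diagonal_apply, map_sub]
      congr 1
      · split_ifs <;> simp
      · have h2 : (Pi.single k (Polynomial.X : Polynomial K) ∘ k.succAbove) =
            fun _ => (0 : Polynomial K) := by
          ext1 i
          simp
        rw [aeval_rename, h2]
        simp [MvPolynomial.aeval_zero']
    rw [h1]
    have h3 : Fintype.card (StairBox d D k) = ∏ i : Fin n, jetWt d D (k.succAbove i) := by
      simp [Fintype.card_pi]
    rw [← h3, ← Matrix.charpoly_natDegree_eq_dim (Matrix.of fun α β => constantCoeff (c α β))]
    exact Matrix.charpoly_monic _

lemma exists_generator_of_isIntegral {K S : Type*} [Field K] [CommRing S] [IsDomain S] [Algebra K S]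
    {n : ℕ} (p : Fin (n + 1) → S) (hind : AlgebraicIndependent K fun i : Fin n => p i.succ)
    (hpi : IsIntegral (Algebra.adjoin K (Set.range fun i : Fin n => p i.succ)) (p 0)) :
    ∃ μ : MvPolynomial (Fin (n + 1)) K, μ ≠ 0 ∧ aeval p μ = 0 ∧ ∀ H, aeval p H = 0 → μ ∣ H := by
  let φ : MvPolynomial (Fin n) K →ₐ[K] S := aeval fun i : Fin n => p i.succ
  let : Algebra (MvPolynomial (Fin n) K) S := φ.toRingHom.toAlgebra
  have hφ : ∀ r, algebraMap (MvPolynomial (Fin n) K) S r = φ r := fun r => rfl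
  have hinj : Function.Injective (algebraMap (MvPolynomial (Fin n) K) S) := hind
  have : Module.IsTorsionFree (MvPolynomial (Fin n) K) S :=
    Module.isTorsionFree_iff_algebraMap_injective.2 hinj
  have hpi' : IsIntegral (MvPolynomial (Fin n) K) (p 0) := by
    obtain ⟨f, hf, hf0⟩ := hpi
    refine ⟨f.map (hind.aevalEquiv.symm : _ →+* MvPolynomial (Fin n) K), hf.map _, ?_⟩
    rw [Polynomial.eval₂_map, ← hf0]
    congr 1
    ext a
    have := hind.algebraMap_aevalEquiv (hind.aevalEquiv.symm a)
    rw [AlgEquiv.apply_symm_apply] at this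
    exact this.symm
  have hev : ∀ H : MvPolynomial (Fin (n + 1)) K,
      aeval p H = Polynomial.aeval (p 0) (finSuccEquiv K n H) := by
    intro H
    induction H using MvPolynomial.induction_on with
    | C a =>
      rw [MvPolynomial.aeval_C, finSuccEquiv_apply]
      simp [hφ, φ]
    | add f g hf hg => rw [map_add, map_add, map_add, hf, hg]
    | mul_X f i hf =>
      rw [map_mul, map_mul, map_mul, hf, aeval_X]
      congr 1
      refine Fin.cases ?_ (fun i => ?_) i
      · rw [finSuccEquiv_X_zero, Polynomial.aeval_X]
      · rw [finSuccEquiv_X_succ, Polynomial.aeval_C, hφ]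
        simp [φ]
  refine ⟨(finSuccEquiv K n).symm (minpoly (MvPolynomial (Fin n) K) (p 0)), ?_, ?_, ?_⟩
  · rw [Ne, EmbeddingLike.map_eq_zero_iff]
    exact minpoly.ne_zero hpi'
  · rw [hev, AlgEquiv.apply_symm_apply, minpoly.aeval]
  · intro H hH
    rw [hev] at hH
    obtain ⟨q, hq⟩ := minpoly.isIntegrallyClosed_dvd hpi' hH
    refine ⟨(finSuccEquiv K n).symm q, ?_⟩
    rw [← map_mul, ← hq, AlgEquiv.symm_apply_apply]

lemma isIntegral_adjoin_jets {K : Type*} [Field K] {n d D : ℕ} (hd : 0 < d)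
    {p : ℕ → MvPolynomial (Fin n) K} (hp : ∀ j ≤ n, (p j).totalDegree ≤ jetWt d D j) {M : ℕ}
    (hli : LinearIndependent K fun γ : {γ : Fin n →₀ ℕ // γ.degree ≤ M} =>
      mixedMon p (stairIdx d D 0 γ.1)) (hM : ∑ j : Fin (n + 1), jetWt d D j ≤ M) :
    Algebra.IsIntegral (Algebra.adjoin K (Set.range fun i : Fin n => p (i.succ : Fin (n + 1))))
      (MvPolynomial (Fin n) K) := by
  set A := Algebra.adjoin K (Set.range fun i : Fin n => p (i.succ : Fin (n + 1))) with hA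
  have hw : ∀ i : Fin n, 0 < jetWt d D ((0 : Fin (n + 1)).succAbove i) := fun i => jetWt_pos hd D _
  rw [Fin.sum_univ_succAbove _ 0] at hM
  set V : Submodule A (MvPolynomial (Fin n) K) :=
    Submodule.span A (Set.range (boxMon K : StairBox d D (0 : Fin (n + 1)) → _)) with hV
  have hexp : ∀ q : MvPolynomial (Fin n) K, q.totalDegree ≤ M → q ∈ V := by
    intro q hq
    obtain ⟨c, -, rfl⟩ := exists_stair_expansion hd hp hli le_rfl hq
    refine sum_mem fun β _ => ?_
    have h1 : aeval (fun i => p ((0 : Fin (n + 1)).succAbove i)) (c β) ∈ A := by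
      rw [hA, Algebra.adjoin_range_eq_range_aeval]
      exact ⟨c β, by simp⟩
    have h2 := V.smul_mem ⟨_, h1⟩ (Submodule.subset_span ⟨β, rfl⟩)
    rwa [Subalgebra.smul_def, smul_eq_mul, mul_comm] at h2
  have hX : ∀ (i : Fin n), ∀ q ∈ V, X i * q ∈ V := by
    intro i q hq
    induction hq using Submodule.span_induction with
    | mem x hx =>
      obtain ⟨β, rfl⟩ := hx
      refine hexp _ ((totalDegree_mul _ _).trans (le_trans ?_ hM))
      rw [totalDegree_X]
      refine add_le_add (by simp [jetWt_zero]) ((totalDegree_boxMon_le β).trans ?_)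
      exact Finset.sum_le_sum fun i _ => (β i).2.le
    | zero => simp
    | add x y _ _ hx hy => rw [mul_add]; exact add_mem hx hy
    | smul a x _ hx => rw [mul_smul_comm]; exact V.smul_mem a hx
  have htop : V = ⊤ := by
    rw [eq_top_iff]
    rintro q -
    induction q using MvPolynomial.induction_on with
    | C a => exact hexp _ (by simp)
    | add f g hf hg => exact add_mem hf hg
    | mul_X f i hf => rw [mul_comm]; exact hX i f hf
  have : Module.Finite A (MvPolynomial (Fin n) K) := by
    refine Module.finite_def.2 ?_
    rw [← htop]
    exact Submodule.fg_span (Set.finite_range _)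
  exact Algebra.IsIntegral.of_finite _ _

lemma exists_generator_of_stair {K : Type*} [Field K] {n d D : ℕ} (hd : 0 < d)
    {p : ℕ → MvPolynomial (Fin n) K} (hp : ∀ j ≤ n, (p j).totalDegree ≤ jetWt d D j) {M : ℕ}
    (hli : LinearIndependent K fun γ : {γ : Fin n →₀ ℕ // γ.degree ≤ M} =>
      mixedMon p (stairIdx d D 0 γ.1)) (hM : ∑ j : Fin (n + 1), jetWt d D j ≤ M) :
    ∃ μ : MvPolynomial (Fin (n + 1)) K, μ ≠ 0 ∧ aeval (fun j : Fin (n + 1) => p j) μ = 0 ∧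
      ∀ H, aeval (fun j : Fin (n + 1) => p j) H = 0 → μ ∣ H := by
  have h1 := isIntegral_adjoin_jets hd hp hli hM
  refine exists_generator_of_isIntegral (fun j : Fin (n + 1) => p j) ?_ (h1.isIntegral _)
  have h2 : Algebra.IsAlgebraic (Algebra.adjoin K
      (Set.range fun i : Fin n => p (i.succ : Fin (n + 1)))) (MvPolynomial (Fin n) K) :=
    inferInstance
  refine (Algebra.IsAlgebraic.isTranscendenceBasis_of_lift_le_trdeg_of_finite K
    (fun i : Fin n => p (i.succ : Fin (n + 1))) ?_).1
  simp [MvPolynomial.trdeg_of_isDomain]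

section
open scoped Polynomial

lemma one_sub_X_pow_eq (k : Type*) [Field k] (a : ℕ) :
    ∃ G : k[X], (1 - Polynomial.X ^ a : k[X]) = (1 - Polynomial.X) * G ∧ G.eval 1 = a := by
  refine ⟨∑ i ∈ Finset.range a, Polynomial.X ^ i, ?_, by simp [Polynomial.eval_finsetSum]⟩
  rw [mul_comm, geom_sum_mul_neg]

lemma elimPoly_ne_zero {k : Type*} [Field k] [CharZero k] {A B κ : k} (hA : A ≠ 0) (hB : B ≠ 0)
    {s : ℕ} (hs : 0 < s) (m : ℕ) :
    Polynomial.C ((-B) ^ (s + m) * B) * (1 - Polynomial.X ^ s) ^ (s + m) *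
        (-((s : k[X]) + 1) * (1 - Polynomial.X ^ s) * (1 - Polynomial.X ^ (s + 1 + m)) + (s : k[X]) * (1 - Polynomial.X ^ (s + m)) * (1 - Polynomial.X ^ (s + 1)))
      - Polynomial.C (κ * A ^ (s + m)) * (1 - Polynomial.X ^ (s + 1)) ^ (s + m + 1) ≠ (0 : k[X]) := by
  intro h
  by_cases hκ : κ = 0
  · have := congrArg (Polynomial.eval 0) h
    simp [hκ, hs.ne', hB] at this
  · obtain ⟨G1, h1, -⟩ := one_sub_X_pow_eq k s
    obtain ⟨G2, h2, e2⟩ := one_sub_X_pow_eq k (s + 1)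
    obtain ⟨G3, h3, -⟩ := one_sub_X_pow_eq k (s + 1 + m)
    obtain ⟨G4, h4, -⟩ := one_sub_X_pow_eq k (s + m)
    rw [h1, h2, h3, h4] at h
    have hX : (1 - Polynomial.X : k[X]) ≠ 0 := by
      intro h
      have := congrArg (Polynomial.eval 0) h
      simp at this
    have h5 : (1 - Polynomial.X : k[X]) ^ (s + m + 1) * (Polynomial.C ((-B) ^ (s + m) * B) * G1 ^ (s + m) * (1 - Polynomial.X) *
        (-((s : k[X]) + 1) * G1 * G3 + (s : k[X]) * G4 * G2) - Polynomial.C (κ * A ^ (s + m)) * G2 ^ (s + m + 1)) = 0 := by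
      rw [← h]
      generalize (1 - Polynomial.X : k[X]) = T
      ring
    have h6 := (mul_eq_zero.1 h5).resolve_left (pow_ne_zero _ hX)
    have := congrArg (Polynomial.eval 1) h6
    simp [e2, hκ, hA] at this
    norm_cast at this

end

lemma tie_injective {k Ω : Type*} [Field k] [Field Ω] [CharZero k] [Algebra k Ω] {A B κ : k}
    {c c' : Ω} {r m : ℕ} (hr : 0 < r) (hA : A ≠ 0) (hc : Transcendental k c)
    (h : (B = 0 ∧ ∃ i, r = 1 + i * m) ∨ (B ≠ 0 ∧ 2 ≤ r))
    (h1 : algebraMap k Ω A * c ^ r + algebraMap k Ω B * c ^ (r - 1) =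
      algebraMap k Ω A * c' ^ r + algebraMap k Ω B * c' ^ (r - 1))
    (h2 : r * algebraMap k Ω A * c ^ (r + m) + (r - 1 : ℕ) * algebraMap k Ω B * c ^ (r + m - 1) =
      r * algebraMap k Ω A * c' ^ (r + m) + (r - 1 : ℕ) * algebraMap k Ω B * c' ^ (r + m - 1)
        + algebraMap k Ω κ) : c = c' := by
  obtain ⟨s, rfl⟩ : ∃ s, r = s + 1 := ⟨r - 1, by omega⟩
  rw [show s + 1 + m - 1 = s + m by omega] at h2
  rw [show s + 1 - 1 = s by omega] at h1 h2
  have halg : ∀ a : k, IsAlgebraic k (algebraMap k Ω a) := fun a => isAlgebraic_algebraMap a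
  have hΩ : CharZero Ω := charZero_of_injective_algebraMap (algebraMap k Ω).injective
  have hc0 : c ≠ 0 := by
    rintro rfl
    exact hc isAlgebraic_zero
  have hA' : algebraMap k Ω A ≠ 0 := by simpa using hA
  obtain ⟨θ, rfl⟩ : ∃ θ, c' = θ * c := ⟨c' / c, by field_simp⟩
  suffices θ = 1 by rw [this, one_mul]
  have e1 : algebraMap k Ω A * c * (1 - θ ^ (s + 1)) = - algebraMap k Ω B * (1 - θ ^ s) := by
    have : c ^ s * (algebraMap k Ω A * c * (1 - θ ^ (s + 1)) -
      (- algebraMap k Ω B * (1 - θ ^ s))) = 0 := by linear_combination h1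
    exact sub_eq_zero.1 ((mul_eq_zero.1 this).resolve_left (pow_ne_zero _ hc0))
  have e2 : c ^ (s + m) * (((s : Ω) + 1) * (algebraMap k Ω A * c) * (1 - θ ^ (s + 1 + m)) +
      s * algebraMap k Ω B * (1 - θ ^ (s + m))) = algebraMap k Ω κ := by
    push_cast at h2
    linear_combination h2
  rcases h with ⟨rfl, i, hi⟩ | ⟨hB, hs⟩
  · have hθ : θ ^ (s + 1) = 1 := by
      simp only [map_zero, neg_zero, zero_mul, mul_eq_zero, hA', hc0, false_or] at e1
      exact (sub_eq_zero.1 e1).symm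
    have hθa : IsAlgebraic k θ := by
      refine IsAlgebraic.of_pow (n := s + 1) (by omega) ?_
      rw [hθ]
      exact isAlgebraic_one
    have hθm : θ ^ m = 1 := by
      by_contra hne
      have h3 : ((s : Ω) + 1) * algebraMap k Ω A * (1 - θ ^ m) ≠ 0 :=
        mul_ne_zero (mul_ne_zero (by norm_cast) hA') (sub_ne_zero.2 (Ne.symm hne))
      have h4 : c ^ (s + m + 1) = algebraMap k Ω κ *
          (((s : Ω) + 1) * algebraMap k Ω A * (1 - θ ^ m))⁻¹ := by
        rw [eq_mul_inv_iff_mul_eq₀ h3, ← e2, pow_add θ, hθ]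
        simp
        ring
      refine hc (IsAlgebraic.of_pow (n := s + m + 1) (by omega) ?_)
      rw [h4]
      refine (halg κ).mul (IsAlgebraic.inv (IsAlgebraic.mul (IsAlgebraic.mul ?_ (halg A)) ?_))
      · simpa using halg ((s : k) + 1)
      · exact isAlgebraic_one.sub (hθa.pow m)
    rw [hi, pow_add, pow_one, mul_comm i, pow_mul, hθm, one_pow, mul_one] at hθ
    exact hθ
  · have hs : 0 < s := by omega
    have hB' : algebraMap k Ω B ≠ 0 := by simpa using hB
    have hθa : IsAlgebraic k θ := by
      refine ⟨_, elimPoly_ne_zero (κ := κ) hA hB hs m, ?_⟩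
      simp only [map_sub, map_mul, map_add, map_neg, map_pow, map_one, Polynomial.aeval_X,
        Polynomial.aeval_C, map_natCast]
      set a := algebraMap k Ω A
      set b := algebraMap k Ω B
      rw [← e2]
      have e3 : (a * c * (1 - θ ^ (s + 1))) ^ (s + m) = (-b * (1 - θ ^ s)) ^ (s + m) := by rw [e1]
      rw [mul_pow, mul_pow, mul_pow] at e3
      generalize 1 - θ ^ (s + 1) = u at *
      generalize 1 - θ ^ s = v at *
      linear_combination -(-(s + 1) * v * (1 - θ ^ (s + 1 + m)) + s * (1 - θ ^ (s + m)) * u) * b * e3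
        - a ^ (s + m) * c ^ (s + m) * u ^ (s + m) * (s + 1) * (1 - θ ^ (s + 1 + m)) * e1
    have hu : 1 - θ ^ (s + 1) = 0 := by
      by_contra hne
      have h4 : c = - algebraMap k Ω B * (1 - θ ^ s) *
          (algebraMap k Ω A * (1 - θ ^ (s + 1)))⁻¹ := by
        rw [eq_mul_inv_iff_mul_eq₀ (mul_ne_zero hA' hne), ← e1]
        ring
      refine hc ?_
      rw [h4]
      exact (((halg B).neg).mul (isAlgebraic_one.sub (hθa.pow _))).mul
        (((halg A).mul (isAlgebraic_one.sub (hθa.pow _))).inv)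
    rw [hu, mul_zero, eq_comm, mul_eq_zero] at e1
    have hv := e1.resolve_left (neg_ne_zero.2 hB')
    have h5 : θ ^ s = 1 := (sub_eq_zero.1 hv).symm
    have h6 : θ ^ s * θ = 1 := by rw [← pow_succ]; exact (sub_eq_zero.1 hu).symm
    rwa [h5, one_mul] at h6

lemma exists_intermediateField_tower {K Ω : Type*} [Field K] [Field Ω] [Algebra K Ω] {y : ℕ → Ω}
    (hy : AlgebraicIndependent K y) : ∃ L : ℕ → IntermediateField K Ω,
      (∀ i z, IsAlgebraic (L i) z → z ∈ L i) ∧ (∀ i, L (i + 1) ≤ L i) ∧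
      (∀ i, y i ∈ L i) ∧ ∀ i, y i ∉ L (i + 1) := by
  let F : ℕ → IntermediateField K Ω := fun i => IntermediateField.adjoin K (y '' Set.Ici i)
  have hF : ∀ i, F (i + 1) ≤ F i := fun i =>
    IntermediateField.adjoin.mono _ _ _ (Set.image_mono (Set.Ici_subset_Ici.2 (Nat.le_succ i)))
  have hmem : ∀ i z, z ∈ (algebraicClosure (F i) Ω).restrictScalars K ↔ IsAlgebraic (F i) z :=
    fun i z => by rw [IntermediateField.mem_restrictScalars, mem_algebraicClosure_iff]
  refine ⟨fun i => (algebraicClosure (F i) Ω).restrictScalars K, ?_, ?_, ?_, ?_⟩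
  · intro i z hz
    rw [hmem]
    have hz' : IsAlgebraic (algebraicClosure (F i) Ω) z := hz
    exact hz'.restrictScalars (F i)
  · intro i z hz
    rw [hmem] at hz ⊢
    exact IsAlgebraic.tower_top_of_subalgebra_le (A := (F (i + 1)).toSubalgebra)
      (B := (F i).toSubalgebra) (hF i) hz
  · intro i
    rw [hmem]
    exact isAlgebraic_algebraMap
      (⟨y i, IntermediateField.subset_adjoin _ _ ⟨i, Set.self_mem_Ici, rfl⟩⟩ : F i)
  · intro i h
    rw [hmem] at h
    have h1 := hy.transcendental_adjoin (s := Set.Ici (i + 1)) (i := i) (by simp)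
    refine h1 ?_
    open scoped IntermediateField.algebraAdjoinAdjoin in
    exact (IsFractionRing.isAlgebraic_iff (Algebra.adjoin K (y '' Set.Ici (i + 1))) (F (i + 1)) Ω).2 h

/-- The coefficient of the second term in the equal-degree tie-breaking polynomial. -/
def tieCoeff (K : Type*) [Field K] (d : ℕ) : K := if d = 1 then 0 else 1

/-- The univariate polynomials governing the leading behaviour of the jets in the tie limit. -/
def tiePoly (K : Type*) [Field K] (d D : ℕ) (j : ℕ) : Polynomial K :=
  eulerIter D (Polynomial.X ^ d + Polynomial.C (tieCoeff K d) * Polynomial.X ^ (d - 1)) j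

lemma tiePoly_two_terms {K : Type*} [Field K] [CharZero K] {d D : ℕ} (hd : 0 < d) (hD : 0 < D)
    (j : ℕ) : ∃ A B : K, A ≠ 0 ∧
      ((B = 0 ∧ ∃ i, jetWt d D (j + 1) = 1 + i * (D - 1)) ∨ (B ≠ 0 ∧ 2 ≤ jetWt d D (j + 1))) ∧
      tiePoly K d D j = Polynomial.C A * Polynomial.X ^ jetWt d D (j + 1) +
          Polynomial.C B * Polynomial.X ^ (jetWt d D (j + 1) - 1) ∧
      tiePoly K d D (j + 1) =
        Polynomial.C ((jetWt d D (j + 1) : ℕ) * A) * Polynomial.X ^ (jetWt d D (j + 1) + (D - 1)) +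
          Polynomial.C (((jetWt d D (j + 1) - 1 : ℕ) : K) * B) *
            Polynomial.X ^ (jetWt d D (j + 1) + (D - 1) - 1) := by
  obtain ⟨A, B, hA, hB0, hB, h1, h2⟩ := eulerIter_two_terms hd hD (tieCoeff K d) j
  refine ⟨A, B, hA, ?_, h1, h2⟩
  rw [jetWt_succ]
  by_cases h : d = 1
  · exact Or.inl ⟨hB0 (by simp [tieCoeff, h]), j, by rw [h]⟩
  · exact Or.inr ⟨hB (by simp [tieCoeff, h]) (by omega), by
      have := Nat.zero_le (j * (D - 1)); omega⟩

lemma eval_zero_tiePoly {K : Type*} [Field K] [CharZero K] {d D : ℕ} (hd : 0 < d) (hD : 0 < D)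
    (j : ℕ) : (tiePoly K d D j).eval 0 = 0 := by
  obtain ⟨A, B, -, h, h1, -⟩ := tiePoly_two_terms (K := K) hd hD j
  have := jetWt_pos hd D (j + 1)
  rw [h1]
  rcases h with ⟨rfl, -⟩ | ⟨-, h2⟩
  · simp [this.ne']
  · simp [this.ne', (show jetWt d D (j + 1) - 1 ≠ 0 by omega)]

lemma natDegree_tiePoly {K : Type*} [Field K] [CharZero K] {d D : ℕ} (hd : 0 < d) (hD : 0 < D)
    (j : ℕ) : (tiePoly K d D j).natDegree = jetWt d D (j + 1) := by
  obtain ⟨A, B, hA, -, h1, -⟩ := tiePoly_two_terms (K := K) hd hD j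
  have := jetWt_pos hd D (j + 1)
  rw [h1, Polynomial.natDegree_add_eq_left_of_natDegree_lt]
  · exact Polynomial.natDegree_C_mul_X_pow _ _ hA
  · rw [Polynomial.natDegree_C_mul_X_pow _ _ hA]
    exact (Polynomial.natDegree_C_mul_X_pow_le _ _).trans_lt (by omega)

lemma exists_tie_solutions {K Ω : Type*} [Field K] [CharZero K] [Field Ω] [IsAlgClosed Ω]
    [Algebra K Ω] {d D : ℕ} (hd : 0 < d) (hD : 0 < D) {y : ℕ → Ω} {L : ℕ → IntermediateField K Ω}
    (hL : ∀ i z, IsAlgebraic (L i) z → z ∈ L i) (hL' : ∀ i, L (i + 1) ≤ L i)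
    (hy : ∀ i, y i ∈ L i) (hy' : ∀ i, y i ∉ L (i + 1)) (n t : ℕ) : ∀ i, i + t = n →
    ∃ T : Finset Ω, T.card = ∏ j ∈ Finset.Ico i n, jetWt d D (j + 1) ∧ ∀ z ∈ T, ∃ x : ℕ → Ω,
      x i = z ∧ x n = 0 ∧ (∀ j, i ≤ j → j ≤ n → x j ∈ L j) ∧ ∀ j, i ≤ j → j < n →
        Polynomial.aeval (x j) (tiePoly K d D j) +
          Polynomial.aeval (x (j + 1)) (tiePoly K d D j) = y j := by
  have hΩ : CharZero Ω := charZero_of_injective_algebraMap (algebraMap K Ω).injective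
  have hmem : ∀ i z (p : Polynomial K), z ∈ L i → Polynomial.aeval z p ∈ L i := by
    intro i z p hz
    have := Polynomial.aeval_algebraMap_apply Ω (⟨z, hz⟩ : L i) p
    rw [show z = algebraMap (L i) Ω ⟨z, hz⟩ from rfl, this]
    exact (Polynomial.aeval (⟨z, hz⟩ : L i) p).2
  classical
  induction t with
  | zero =>
    rintro i rfl
    refine ⟨{0}, by simp, ?_⟩
    intro z hz
    rw [Finset.mem_singleton] at hz
    subst hz
    exact ⟨fun _ => 0, rfl, rfl, fun j _ _ => zero_mem _, fun j h1 h2 => by omega⟩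
  | succ t ih =>
    intro i hi
    obtain ⟨T, hT, hx⟩ := ih (i + 1) (by omega)
    obtain ⟨A, B, hA, hAB, e1, e2⟩ := tiePoly_two_terms (K := K) hd hD i
    set H := tiePoly K d D i with hH
    let R : Ω → Polynomial Ω := fun c =>
      H.map (algebraMap K Ω) - Polynomial.C (y i - Polynomial.aeval c H)
    have hdeg : H.natDegree = jetWt d D (i + 1) := natDegree_tiePoly hd hD i
    have hRdeg : ∀ c, (R c).natDegree = jetWt d D (i + 1) := by
      intro c
      rw [Polynomial.natDegree_sub_C, Polynomial.natDegree_map, hdeg]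
    have hR0 : ∀ c, R c ≠ 0 := by
      intro c h
      have := hRdeg c
      rw [h, Polynomial.natDegree_zero] at this
      exact absurd this (jetWt_pos hd D _).ne
    have hroot : ∀ c z, z ∈ (R c).roots ↔
        Polynomial.aeval z H + Polynomial.aeval c H = y i := by
      intro c z
      rw [Polynomial.mem_roots (hR0 c), Polynomial.IsRoot.def, Polynomial.eval_sub,
        Polynomial.eval_C, Polynomial.eval_map_algebraMap, sub_eq_zero, eq_sub_iff_add_eq]
    have hTL : ∀ c ∈ T, c ∈ L (i + 1) := by
      intro c hc
      obtain ⟨x, rfl, -, h, -⟩ := hx c hc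
      exact h _ le_rfl (by omega)
    have hnodup : ∀ c ∈ T, (R c).roots.Nodup := by
      intro c hc
      rw [Multiset.nodup_iff_count_le_one]
      intro z
      rw [Polynomial.count_roots]
      by_contra! h
      obtain ⟨h1, h2⟩ := (Polynomial.one_lt_rootMultiplicity_iff_isRoot (hR0 c)).1 h
      rw [Polynomial.derivative_sub, Polynomial.derivative_C, sub_zero, Polynomial.derivative_map,
        Polynomial.IsRoot.def, Polynomial.eval_map_algebraMap] at h2
      have hz : z ∈ L (i + 1) := by
        refine hL _ _ (IsAlgebraic.tower_top (K := K) (L (i + 1)) ⟨_, ?_, h2⟩)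
        intro h0
        have := Polynomial.derivative_eq_zero.1 h0
        rw [hdeg] at this
        exact (jetWt_pos hd D _).ne' this
      refine hy' i ?_
      rw [← (hroot c z).1 ((Polynomial.mem_roots (hR0 c)).2 h1)]
      exact add_mem (hmem _ _ _ hz) (hmem _ _ _ (hTL c hc))
    have hinj : ∀ c ∈ T, ∀ c' ∈ T, Polynomial.aeval c H = Polynomial.aeval c' H → c = c' := by
      intro c hc c' hc' hcc
      obtain ⟨x, rfl, hx0, hxL, hxe⟩ := hx c hc
      obtain ⟨x', rfl, hx0', hxL', hxe'⟩ := hx c' hc'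
      rcases Nat.lt_or_ge (i + 1) n with hin | hin
      · have h1 := hxe (i + 1) le_rfl hin
        have h2 := hxe' (i + 1) le_rfl hin
        have hκ : Polynomial.aeval (x' (i + 1 + 1)) (tiePoly K d D (i + 1)) -
            Polynomial.aeval (x (i + 1 + 1)) (tiePoly K d D (i + 1)) ∈ L (i + 1 + 1) :=
          sub_mem (hmem _ _ _ (hxL' _ (by omega) (by omega)))
            (hmem _ _ _ (hxL _ (by omega) (by omega)))
        have htr : Transcendental (L (i + 1 + 1)) (x (i + 1)) := by
          intro h
          refine hy' (i + 1) ?_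
          rw [← h1]
          exact add_mem (hmem _ _ _ (hL _ _ h)) (hmem _ _ _ (hxL _ (by omega) (by omega)))
        have hmap : ∀ a : K, algebraMap (L (i + 1 + 1)) Ω (algebraMap K (L (i + 1 + 1)) a) =
          algebraMap K Ω a := fun a => rfl
        refine tie_injective (k := L (i + 1 + 1)) (A := algebraMap K _ A) (B := algebraMap K _ B)
          (κ := ⟨_, hκ⟩) (r := jetWt d D (i + 1)) (m := D - 1) (jetWt_pos hd D _) (by simpa using hA)
          htr (by simpa using hAB) ?_ ?_
        · rw [hmap, hmap]
          simpa [e1] using hcc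
        · rw [hmap, hmap]
          have h3 := h1.trans h2.symm
          rw [← sub_eq_zero] at h3
          rw [← sub_eq_zero, ← h3]
          have h4 : ∀ z : Ω, Polynomial.aeval z (tiePoly K d D (i + 1)) = _ := fun z => by
            rw [e2]
          rw [h4 (x (i + 1)), h4 (x' (i + 1))]
          change _ - (_ + (Polynomial.aeval (x' (i + 1 + 1)) (tiePoly K d D (i + 1)) -
            Polynomial.aeval (x (i + 1 + 1)) (tiePoly K d D (i + 1)))) = _
          simp only [map_add, map_mul, map_pow, Polynomial.aeval_X, Polynomial.aeval_C, map_natCast]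
          ring
      · obtain rfl : i + 1 = n := by omega
        rw [hx0, hx0']
    refine ⟨T.biUnion fun c => (R c).roots.toFinset, ?_, ?_⟩
    · rw [Finset.card_biUnion, Finset.sum_congr rfl (g := fun _ => jetWt d D (i + 1))]
      · rw [Finset.sum_const, hT, smul_eq_mul, mul_comm,
          Finset.prod_eq_prod_Ico_succ_bot (show i < n by omega)]
      · intro c hc
        rw [Multiset.toFinset_card_of_nodup (hnodup c hc), ← hRdeg c]
        exact (IsAlgClosed.splits (R c)).natDegree_eq_card_roots.symm
      · intro c hc c' hc' hne
        rw [Function.onFun, Finset.disjoint_left]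
        intro z hz hz'
        rw [Multiset.mem_toFinset, hroot] at hz hz'
        exact hne (hinj c hc c' hc' (add_left_cancel (hz.trans hz'.symm)))
    · intro z hz
      rw [Finset.mem_biUnion] at hz
      obtain ⟨c, hc, hz⟩ := hz
      rw [Multiset.mem_toFinset, hroot] at hz
      obtain ⟨x, rfl, hx0, hxL, hxe⟩ := hx c hc
      refine ⟨Function.update x i z, by simp, ?_, ?_, ?_⟩
      · rw [Function.update_of_ne (by omega), hx0]
      · intro j h1 h2
        rcases h1.eq_or_lt with rfl | h1
        · rw [Function.update_self]
          have hm : y i - Polynomial.aeval (x (i + 1)) H ∈ L i :=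
            sub_mem (hy i) (hmem _ _ _ (hL' i (hTL _ hc)))
          refine hL _ _ ⟨H.map (algebraMap K (L i)) - Polynomial.C ⟨_, hm⟩, ?_, ?_⟩
          · intro h0
            have := congrArg Polynomial.natDegree h0
            rw [Polynomial.natDegree_sub_C, Polynomial.natDegree_map, hdeg,
              Polynomial.natDegree_zero] at this
            exact (jetWt_pos hd D _).ne' this
          · rw [map_sub, Polynomial.aeval_map_algebraMap, Polynomial.aeval_C, sub_eq_zero]
            exact eq_sub_of_add_eq hz
        · rw [Function.update_of_ne (by omega)]
          exact hxL j h1 h2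
      · intro j h1 h2
        rw [Function.update_of_ne (a := j + 1) (by omega)]
        rcases h1.eq_or_lt with rfl | h1
        · rwa [Function.update_self]
        · rw [Function.update_of_ne (by omega)]
          exact hxe j h1 h2

/-- The exponents of weight at most `∏ j, jetWt d D j` when `x_1^{(j)}` has weight
`jetWt d D j`. -/
def simplexExps (n d D : ℕ) : Finset (Fin (n + 1) →₀ ℕ) :=
  {e ∈ Finset.Icc 0 (Finsupp.equivFunOnFinite.symm fun _ => ∏ j : Fin (n + 1), jetWt d D j) |
    Finsupp.weight (fun j : Fin (n + 1) => jetWt d D j) e ≤ ∏ j : Fin (n + 1), jetWt d D j}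

lemma mem_simplexExps {n d D : ℕ} (hd : 0 < d) {e : Fin (n + 1) →₀ ℕ} : e ∈ simplexExps n d D ↔
    Finsupp.weight (fun j : Fin (n + 1) => jetWt d D j) e ≤ ∏ j : Fin (n + 1), jetWt d D j := by
  rw [simplexExps, Finset.mem_filter, and_iff_right_iff_imp]
  intro h
  rw [Finset.mem_Icc]
  refine ⟨fun j => zero_le, fun j => ?_⟩
  rw [Finsupp.equivFunOnFinite_symm_apply_apply]
  exact (Finsupp.le_weight (fun j : Fin (n + 1) => jetWt d D j) (jetWt_pos hd D j).ne' e).trans h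

lemma linearIndependent_mixedMon_zero_iff {K : Type*} [Field K] {n : ℕ}
    {S : Finset (Fin (n + 1) →₀ ℕ)} {p : ℕ → MvPolynomial (Fin n) K} :
    (LinearIndependent K fun e : S => mixedMon p (0, e.1)) ↔
      ∀ G : MvPolynomial (Fin (n + 1)) K, G.support ⊆ S →
        aeval (fun j : Fin (n + 1) => p j) G = 0 → G = 0 := by
  have key : ∀ e : Fin (n + 1) →₀ ℕ, mixedMon p (0, e) =
      aeval (fun j : Fin (n + 1) => p j) (monomial e (1 : K)) := by
    intro e
    rw [aeval_monomial, map_one, one_mul, Finsupp.prod_fintype _ _ (by simp), mixedMon]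
    simp
  rw [Fintype.linearIndependent_iff]
  constructor
  · intro h G hG h0
    ext e
    rw [coeff_zero]
    by_contra hne
    refine hne (h (fun e => coeff e.1 G) ?_ ⟨e, hG (mem_support_iff.2 hne)⟩)
    rw [← h0]
    calc ∑ e : S, coeff e.1 G • mixedMon p (0, e.1)
        = ∑ e : S, aeval (fun j : Fin (n + 1) => p j) (monomial e.1 (coeff e.1 G)) := by
          refine Finset.sum_congr rfl fun e _ => ?_
          rw [key, ← map_smul, smul_monomial, smul_eq_mul, mul_one]
      _ = ∑ e ∈ S, aeval (fun j : Fin (n + 1) => p j) (monomial e (coeff e G)) :=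
          Finset.sum_coe_sort S fun e => aeval (fun j : Fin (n + 1) => p j) (monomial e (coeff e G))
      _ = ∑ e ∈ G.support, aeval (fun j : Fin (n + 1) => p j) (monomial e (coeff e G)) := by
          refine (Finset.sum_subset hG fun e _ he => ?_).symm
          rw [notMem_support_iff.1 he, monomial_zero, map_zero]
      _ = aeval (fun j : Fin (n + 1) => p j) G := by
          rw [← map_sum, support_sum_monomial_coeff]
  · intro h c hc e
    have hG := h (∑ e : S, monomial e.1 (c e)) ?_ ?_
    · have := congrArg (coeff e.1) hG
      rw [coeff_sum, coeff_zero, Finset.sum_eq_single e] at this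
      · rwa [coeff_monomial, if_pos rfl] at this
      · intro b _ hb
        rw [coeff_monomial, if_neg (fun h => hb (Subtype.ext h))]
      · simp
    · refine support_sum.trans ?_
      intro m hm
      rw [Finset.mem_biUnion] at hm
      obtain ⟨b, -, hb⟩ := hm
      have := support_monomial_subset hb
      rw [Finset.mem_singleton] at this
      rw [this]
      exact b.2
    · rw [map_sum, ← hc]
      refine Finset.sum_congr rfl fun e _ => ?_
      rw [key, ← map_smul, smul_monomial, smul_eq_mul, mul_one]

lemma aeval_cons_eq_eval_map {K Ω : Type*} [Field K] [CommRing Ω] [Algebra K Ω] {n : ℕ}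
    (z : Ω) (y : Fin n → Ω) (G : MvPolynomial (Fin (n + 1)) K) :
    aeval (Fin.cons z y : Fin (n + 1) → Ω) G =
      ((finSuccEquiv K n G).map (aeval y : MvPolynomial (Fin n) K →ₐ[K] Ω).toRingHom).eval z := by
  induction G using MvPolynomial.induction_on with
  | C a => simp [finSuccEquiv_apply]
  | add f g hf hg => rw [map_add, map_add, Polynomial.map_add, Polynomial.eval_add, hf, hg]
  | mul_X f i hf =>
    rw [map_mul, map_mul, Polynomial.map_mul, Polynomial.eval_mul, hf, aeval_X]
    congr 1
    refine Fin.cases ?_ (fun i => ?_) i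
    · simp [finSuccEquiv_X_zero]
    · simp [finSuccEquiv_X_succ]

lemma sum_ite_consecutive {M : Type*} [AddCommMonoid M] {n j : ℕ} (hj : j < n) (F : ℕ → M)
    (hF : F n = 0) :
    (∑ i : Fin n, if (i : ℕ) = j ∨ (i : ℕ) = j + 1 then F i else 0) = F j + F (j + 1) := by
  rw [Fin.sum_univ_eq_sum_range (fun i => if i = j ∨ i = j + 1 then F i else 0)]
  have h1 : ∀ i, (if i = j ∨ i = j + 1 then F i else 0) =
      (if j = i then F i else 0) + if j + 1 = i then F i else 0 := by
    intro i
    by_cases h : j = i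
    · subst h
      simp
    · simp [h, Ne.symm h, eq_comm]
  simp only [h1]
  rw [Finset.sum_add_distrib, Finset.sum_ite_eq, Finset.sum_ite_eq,
    if_pos (Finset.mem_range.2 hj)]
  congr 1
  rw [ite_eq_left_iff]
  intro h
  rw [Finset.mem_range] at h
  rw [show j + 1 = n by omega, hF]

lemma eq_zero_of_aeval_tie {K : Type*} [Field K] [CharZero K] {n d D : ℕ} [NeZero n] (hd : 0 < d)
    (hD : 0 < D) {p : ℕ → MvPolynomial (Fin n) K} (hp0 : p 0 = X 0)
    (hp : ∀ j < n, p (j + 1) = ∑ i : Fin n, if (i : ℕ) = j ∨ (i : ℕ) = j + 1 then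
      Polynomial.aeval (X i) (tiePoly K d D j) else 0)
    {G : MvPolynomial (Fin (n + 1)) K} (hG : G.degreeOf 0 < ∏ j : Fin (n + 1), jetWt d D j)
    (h0 : aeval (fun j : Fin (n + 1) => p j) G = 0) : G = 0 := by
  let Ω := AlgebraicClosure (FractionRing (MvPolynomial ℕ K))
  let y : ℕ → Ω := fun i => algebraMap (MvPolynomial ℕ K) Ω (X i)
  have hyi : AlgebraicIndependent K y := by
    refine (MvPolynomial.algebraicIndependent_X ℕ K).map'
      (f := IsScalarTower.toAlgHom K (MvPolynomial ℕ K) Ω) ?_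
    change Function.Injective (algebraMap (MvPolynomial ℕ K) Ω)
    rw [IsScalarTower.algebraMap_eq (MvPolynomial ℕ K) (FractionRing (MvPolynomial ℕ K)) Ω]
    exact (algebraMap (FractionRing (MvPolynomial ℕ K)) Ω).injective.comp
      (IsFractionRing.injective _ _)
  obtain ⟨L, hL, hL', hy, hy'⟩ := exists_intermediateField_tower hyi
  obtain ⟨T, hT, hx⟩ := exists_tie_solutions hd hD hL hL' hy hy' n n 0 (by simp)
  have hyi' : AlgebraicIndependent K fun i : Fin n => y i := hyi.comp _ Fin.val_injective
  set f := (finSuccEquiv K n G).map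
    (aeval (fun i : Fin n => y i) : MvPolynomial (Fin n) K →ₐ[K] Ω).toRingHom with hf
  have hroot : ∀ z ∈ T, f.eval z = 0 := by
    intro z hz
    obtain ⟨x, rfl, hxn, -, hxe⟩ := hx z hz
    rw [hf, ← aeval_cons_eq_eval_map]
    have h1 : (Fin.cons (x 0) (fun i : Fin n => y i) : Fin (n + 1) → Ω) =
        fun j : Fin (n + 1) => aeval (fun i : Fin n => x i) (p j) := by
      ext j
      refine Fin.cases ?_ (fun j => ?_) j
      · simp [hp0]
      · rw [Fin.cons_succ, Fin.val_succ, hp _ j.2, map_sum, ← hxe j (Nat.zero_le _) j.2]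
        rw [← sum_ite_consecutive j.2 fun i => Polynomial.aeval (x i) (tiePoly K d D j)]
        · refine Finset.sum_congr rfl fun i _ => ?_
          rw [apply_ite (aeval fun i : Fin n => x i), map_zero, ← Polynomial.aeval_algHom_apply,
            aeval_X]
        · simp only [hxn]
          rw [← map_zero (algebraMap K Ω), Polynomial.aeval_algebraMap_apply,
            Polynomial.coe_aeval_eq_eval, eval_zero_tiePoly hd hD, map_zero]
    have h2 := congrArg (fun φ => φ G) (comp_aeval (fun j : Fin (n + 1) => p j)
      (aeval fun i : Fin n => x i : MvPolynomial (Fin n) K →ₐ[K] Ω))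
    rw [h1, ← h2, AlgHom.comp_apply, h0, map_zero]
  have hf0 : f = 0 := by
    refine Polynomial.eq_zero_of_natDegree_lt_card_of_eval_eq_zero' f T hroot ?_
    refine (Polynomial.natDegree_map_le).trans_lt ?_
    rw [natDegree_finSuccEquiv, hT]
    refine hG.trans_eq ?_
    rw [Fin.prod_univ_succ]
    simp only [Fin.val_zero, jetWt_zero, one_mul, Fin.val_succ]
    exact (Finset.prod_range fun j => jetWt d D (j + 1)).symm.trans (by rw [Finset.range_eq_Ico])
  rw [hf, Polynomial.map_eq_zero_iff hyi'] at hf0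
  exact (EmbeddingLike.map_eq_zero_iff).1 hf0

lemma degreeOf_zero_lt_of_support_subset {K : Type*} [Field K] {n d D : ℕ} (hd : 0 < d)
    {G : MvPolynomial (Fin (n + 1)) K} (hG : G.support ⊆ (simplexExps n d D).erase
      (Finsupp.single 0 (∏ j : Fin (n + 1), jetWt d D j))) :
    G.degreeOf 0 < ∏ j : Fin (n + 1), jetWt d D j := by
  have hpos : 0 < ∏ j : Fin (n + 1), jetWt d D j := Finset.prod_pos fun j _ => jetWt_pos hd D _
  rw [degreeOf_lt_iff hpos]
  intro e he
  have h1 := hG he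
  rw [Finset.mem_erase, mem_simplexExps hd] at h1
  obtain ⟨h1, h3⟩ := h1
  rw [Finsupp.weight_apply, Finsupp.sum_fintype _ _ (by simp), Fin.sum_univ_succ] at h3
  simp only [Fin.val_zero, jetWt_zero, smul_eq_mul, mul_one] at h3
  by_contra! hle
  have h2 : ∑ i : Fin n, e i.succ * jetWt d D (i.succ : Fin (n + 1)) = 0 := by omega
  refine h1 ?_
  ext j
  refine Fin.cases ?_ (fun j => ?_) j
  · rw [Finsupp.single_eq_same]
    omega
  · have := (Finset.sum_eq_zero_iff.1 h2) j (Finset.mem_univ _)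
    rw [Finsupp.single_eq_of_ne (Fin.succ_ne_zero j)]
    exact (mul_eq_zero.1 this).resolve_right (jetWt_pos hd D _).ne'

lemma exists_open_forall_eq_zero {K : Type*} [Field K] {n d D : ℕ} [NeZero n]
    (S : Finset (Fin (n + 1) →₀ ℕ))
    {g : Fin n → MvPolynomial (Fin n) (Polynomial K)} (hg : Adm d D g) (E : ℕ → ℕ)
    (q : ℕ → MvPolynomial (Fin n) (Polynomial K))
    (hq : ∀ j ≤ n, jet g j = C (Polynomial.X ^ E j) * q j)
    (h0 : ∀ G : MvPolynomial (Fin (n + 1)) K, G.support ⊆ S →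
      aeval (fun j : Fin (n + 1) => map (Polynomial.evalRingHom (0 : K)) (q j)) G = 0 → G = 0) :
    ∃ P : MvPolynomial (CoeffIdx n d D) K, P ≠ 0 ∧
      ∀ g : Fin n → MvPolynomial (Fin n) K, Adm d D g → spec K d D g P ≠ 0 →
        ∀ G : MvPolynomial (Fin (n + 1)) K, G.support ⊆ S →
          aeval (fun j : Fin (n + 1) => jet g j) G = 0 → G = 0 := by
  obtain ⟨P, hP, h⟩ := exists_open_linearIndependent (fun e : S => (0, e.1)) hg E q hq
    (linearIndependent_mixedMon_zero_iff.2 h0)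
  exact ⟨P, hP, fun g hg hs => linearIndependent_mixedMon_zero_iff.1 (h g hg hs)⟩

lemma exists_open_simplexExps_erase (K : Type*) [Field K] [CharZero K] {n d D : ℕ} [NeZero n]
    (hd : 0 < d) (hD : 0 < D) : ∃ P : MvPolynomial (CoeffIdx n d D) K, P ≠ 0 ∧
      ∀ g : Fin n → MvPolynomial (Fin n) K, Adm d D g → spec K d D g P ≠ 0 →
        ∀ G : MvPolynomial (Fin (n + 1)) K,
          G.support ⊆ (simplexExps n d D).erase
            (Finsupp.single 0 (∏ j : Fin (n + 1), jetWt d D j)) →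
          aeval (fun j : Fin (n + 1) => jet g j) G = 0 → G = 0 := by
  obtain ⟨g, E, q, hg, hq, hq0, hqj⟩ := exists_tie_limit (n := n) d D (tieCoeff K d)
  exact exists_open_forall_eq_zero _ hg E q hq fun G hG h0 =>
    eq_zero_of_aeval_tie (p := fun j => map (Polynomial.evalRingHom (0 : K)) (q j)) hd hD hq0 hqj (degreeOf_zero_lt_of_support_subset hd hG) h0

lemma coeff_aeval_X_pow {τ R : Type*} [CommRing R] [Fintype τ] (w : τ → ℕ) (hw : ∀ j, 0 < w j)
    (f : MvPolynomial τ R) (e : τ →₀ ℕ) :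
    coeff (Finsupp.equivFunOnFinite.symm fun j => w j * e j)
      (aeval (fun j => (X j : MvPolynomial τ R) ^ w j) f) = coeff e f := by
  classical
  have hmon : ∀ (e : τ →₀ ℕ) (a : R),
      aeval (fun j => (X j : MvPolynomial τ R) ^ w j) (monomial e a) =
        monomial (Finsupp.equivFunOnFinite.symm fun j => w j * e j) a := by
    intro e a
    rw [aeval_monomial, monomial_eq, Finsupp.prod_fintype _ _ (by simp),
      Finsupp.prod_fintype _ _ (by simp)]
    simp [pow_mul, algebraMap_eq]
  induction f using MvPolynomial.induction_on' with
  | monomial e' a =>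
    rw [hmon, coeff_monomial, coeff_monomial]
    congr 1
    rw [EmbeddingLike.apply_eq_iff_eq, eq_iff_iff, DFunLike.ext_iff (f := e'),
      _root_.funext_iff]
    exact forall_congr' fun j => Nat.mul_right_inj (hw j).ne'
  | add p q hp hq => rw [map_add, coeff_add, coeff_add, hp, hq]

lemma totalDegree_aeval_X_pow_le_iff {τ R : Type*} [CommRing R] [Fintype τ] {w : τ → ℕ}
    (hw : ∀ j, 0 < w j) {f : MvPolynomial τ R} {N : ℕ} :
    (aeval (fun j => (X j : MvPolynomial τ R) ^ w j) f).totalDegree ≤ N ↔ WtLE w N f := by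
  classical
  constructor
  · intro h e he
    have h1 : coeff (Finsupp.equivFunOnFinite.symm fun j => w j * e j)
        (aeval (fun j => (X j : MvPolynomial τ R) ^ w j) f) ≠ 0 := by
      rw [coeff_aeval_X_pow w hw]
      exact mem_support_iff.1 he
    have h2 := (le_totalDegree (mem_support_iff.2 h1)).trans h
    rw [Finsupp.sum_fintype _ _ (by simp)] at h2
    rw [Finsupp.weight_apply, Finsupp.sum_fintype _ _ (by simp)]
    refine Nat.cast_le.2 (le_trans (le_of_eq (Finset.sum_congr rfl fun j _ => ?_)) h2)
    simp [mul_comm]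
  · intro h
    rw [aeval_def, eval₂_eq]
    refine totalDegree_finsetSum_le fun e he => ?_
    have h1 := h e he
    rw [Finsupp.weight_apply, Finsupp.sum_fintype _ _ (by simp), Nat.cast_le] at h1
    refine (totalDegree_mul _ _).trans ?_
    rw [algebraMap_eq, totalDegree_C, zero_add]
    refine (totalDegree_finsetProd _ _).trans (le_trans ?_ h1)
    refine (Finset.sum_le_univ_sum_of_nonneg fun _ => Nat.zero_le _).trans
      (Finset.sum_le_sum fun j _ => ?_)
    refine (totalDegree_pow _ _).trans ?_
    rw [smul_eq_mul]
    refine Nat.mul_le_mul_left _ ((totalDegree_pow _ _).trans ?_)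
    cases subsingleton_or_nontrivial R
    · simp [Subsingleton.elim (X j : MvPolynomial τ R) 0]
    · rw [totalDegree_X, mul_one]

lemma aeval_X_pow_ne_zero {τ R : Type*} [CommRing R] [Fintype τ] {w : τ → ℕ}
    (hw : ∀ j, 0 < w j) {f : MvPolynomial τ R} (hf : f ≠ 0) :
    aeval (fun j => (X j : MvPolynomial τ R) ^ w j) f ≠ 0 := by
  obtain ⟨e, he⟩ := exists_coeff_ne_zero hf
  intro h0
  rw [← coeff_aeval_X_pow w hw, h0, coeff_zero] at he
  exact he rfl

lemma wtLE_of_dvd {τ R : Type*} [CommRing R] [IsDomain R] [Fintype τ] {w : τ → ℕ}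
    (hw : ∀ j, 0 < w j) {f g : MvPolynomial τ R} {N : ℕ} (hg0 : g ≠ 0) (hfg : f ∣ g)
    (hg : WtLE w N g) : WtLE w N f := by
  obtain ⟨h, rfl⟩ := hfg
  rw [← totalDegree_aeval_X_pow_le_iff hw] at hg ⊢
  have hne := aeval_X_pow_ne_zero hw hg0
  rw [map_mul] at hne hg
  rw [totalDegree_mul_of_isDomain (left_ne_zero_of_mul hne) (right_ne_zero_of_mul hne)] at hg
  omega

lemma exists_eq_mul_C_of_wtLE {τ R : Type*} [CommRing R] [IsDomain R] [Fintype τ] {w : τ → ℕ}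
    (hw : ∀ j, 0 < w j) {f g : MvPolynomial τ R} {N : ℕ} (hfg : f ∣ g)
    (hg : WtLE w N g) {e : τ →₀ ℕ} (he : coeff e f ≠ 0) (heN : Finsupp.weight w e = N) :
    ∃ a, g = f * C a := by
  classical
  obtain ⟨h, rfl⟩ := hfg
  by_cases hh : h = 0
  · exact ⟨0, by simp [hh]⟩
  have hf : f ≠ 0 := by rintro rfl; simp at he
  rw [← totalDegree_aeval_X_pow_le_iff hw, map_mul,
    totalDegree_mul_of_isDomain (aeval_X_pow_ne_zero hw hf) (aeval_X_pow_ne_zero hw hh)] at hg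
  have h1 := totalDegree_aeval_X_pow_le_iff hw (N := _) |>.1
    (le_refl (aeval (fun j => (X j : MvPolynomial τ R) ^ w j) f).totalDegree) e
    (mem_support_iff.2 he)
  rw [heN, Nat.cast_le] at h1
  have h2 : (aeval (fun j => (X j : MvPolynomial τ R) ^ w j) h).totalDegree ≤ 0 := by omega
  rw [totalDegree_aeval_X_pow_le_iff hw] at h2
  refine ⟨coeff 0 h, ?_⟩
  congr 1
  ext e'
  rw [coeff_C]
  split_ifs with h0
  · rw [h0]
  · by_contra h3
    have h4 := h2 e' (mem_support_iff.2 h3)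
    apply h0
    ext j
    have h5 := Finsupp.le_weight w (hw j).ne' e'
    rw [Finsupp.zero_apply]
    omega

lemma wtLE_iff_support_subset {R : Type*} [CommRing R] {n d D : ℕ} (hd : 0 < d)
    {f : MvPolynomial (Fin (n + 1)) R} :
    WtLE (fun j : Fin (n + 1) => jetWt d D j) (∏ j : Fin (n + 1), jetWt d D j : ℕ) f ↔
      f.support ⊆ simplexExps n d D := by
  refine forall_congr' fun e => imp_congr_right fun _ => ?_
  rw [mem_simplexExps hd, Nat.cast_le]

lemma exists_simplex_generator {K : Type*} [Field K] {n d D : ℕ} (hd : 0 < d)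
    {p : ℕ → MvPolynomial (Fin n) K} (hp : ∀ j ≤ n, (p j).totalDegree ≤ jetWt d D j) {M : ℕ}
    (hli : ∀ k : Fin (n + 1), LinearIndependent K fun γ : {γ : Fin n →₀ ℕ // γ.degree ≤ M} =>
      mixedMon p (stairIdx d D k γ.1)) (hM : ∑ j : Fin (n + 1), jetWt d D j ≤ M)
    (hz : ∀ G : MvPolynomial (Fin (n + 1)) K,
      G.support ⊆ (simplexExps n d D).erase
        (Finsupp.single 0 (∏ j : Fin (n + 1), jetWt d D j)) →
      aeval (fun j : Fin (n + 1) => p j) G = 0 → G = 0) :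
    ∃ μ : MvPolynomial (Fin (n + 1)) K, aeval (fun j : Fin (n + 1) => p j) μ = 0 ∧
      (∀ H, aeval (fun j : Fin (n + 1) => p j) H = 0 → μ ∣ H) ∧
      μ.support ⊆ simplexExps n d D ∧
      ∀ k : Fin (n + 1),
        coeff (Finsupp.single k (∏ i : Fin n, jetWt d D (k.succAbove i))) μ ≠ 0 := by
  obtain ⟨μ, hμ0, hμ, hdvd⟩ := exists_generator_of_stair hd hp (hli 0) hM
  have hw : ∀ j : Fin (n + 1), 0 < jetWt d D j := fun j => jetWt_pos hd D j
  choose F hF0 hFw hF1 using fun k => exists_relation hd hp (hli k) hM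
  have hne : F 0 ≠ 0 := by
    intro h
    have := hF1 0
    rw [h, coeff_zero] at this
    exact zero_ne_one this
  have hμw := wtLE_of_dvd hw hne (hdvd _ (hF0 0)) (hFw 0)
  have hsupp := (wtLE_iff_support_subset hd).1 hμw
  have htop : coeff (Finsupp.single 0 (∏ j : Fin (n + 1), jetWt d D j)) μ ≠ 0 := by
    intro h
    refine hμ0 (hz μ (fun e he => Finset.mem_erase.2 ⟨?_, hsupp he⟩) hμ)
    rintro rfl
    exact mem_support_iff.1 he h
  refine ⟨μ, hμ, hdvd, hsupp, fun k hk => ?_⟩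
  obtain ⟨a, ha⟩ := exists_eq_mul_C_of_wtLE hw (hdvd _ (hF0 k)) (hFw k) htop
    (by simp [Finsupp.weight_single, jetWt_zero])
  have := hF1 k
  rw [ha, mul_comm, coeff_C_mul, hk, mul_zero] at this
  exact zero_ne_one this

lemma exists_adm_spec_ne_zero {K : Type*} [Field K] [Infinite K] {n d D : ℕ} [NeZero n]
    {P : MvPolynomial (CoeffIdx n d D) K} (hP : P ≠ 0) :
    ∃ g : Fin n → MvPolynomial (Fin n) K, Adm d D g ∧ spec K d D g P ≠ 0 := by
  classical
  obtain ⟨x, hx⟩ : ∃ x, eval x P ≠ 0 := by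
    by_contra! h
    exact hP (MvPolynomial.funext fun x => by rw [h, map_zero])
  have hcoeff : ∀ p : CoeffIdx n d D, coeff p.1.2 (genericSys K n d D p.1.1) = X p := by
    rintro ⟨⟨i, m⟩, hm⟩
    dsimp only at hm ⊢
    rw [genericSys, coeff_sum, Finset.sum_eq_single m, dif_pos hm, coeff_monomial, if_pos rfl]
    · intro m' _ hne
      by_cases h : ∑ j, m' j ≤ if i = 0 then d else D
      · rw [dif_pos h, coeff_monomial, if_neg hne]
      · rw [dif_neg h, coeff_zero]
    · intro h
      refine absurd ((Set.Finite.mem_toFinset _).2 ?_) h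
      rw [Set.mem_ofPred_eq, Finsupp.degree_eq_sum]
      refine hm.trans ?_
      split_ifs <;> simp
  have hdeg : ∀ i, (genericSys K n d D i).totalDegree ≤ if i = 0 then d else D := by
    intro i
    refine totalDegree_finsetSum_le fun m _ => ?_
    by_cases h : ∑ j, m j ≤ if i = 0 then d else D
    · rw [dif_pos h]
      refine (totalDegree_monomial_le _ _).trans ?_
      rwa [Finsupp.sum_fintype _ _ (fun _ => rfl)]
    · rw [dif_neg h]
      simp
  refine ⟨fun i => map (eval x) (genericSys K n d D i), fun i => ?_, ?_⟩
  · exact (Finset.sup_mono (support_map_subset _ _)).trans (hdeg i)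
  · convert hx
    simp only [spec, coeff_map, hcoeff, eval_X]
    exact DFunLike.congr_fun (MvPolynomial.coe_aeval_eq_eval x) P

/-- Translation of the variables. -/
def shiftVars {τ R : Type*} [CommRing R] (c : τ → R) : MvPolynomial τ R →ₐ[R] MvPolynomial τ R :=
  aeval fun j => X j + C (c j)

lemma shiftVars_X {τ R : Type*} [CommRing R] (c : τ → R) (j : τ) :
    shiftVars c (X j) = X j + C (c j) := aeval_X _ _

lemma shiftVars_C {τ R : Type*} [CommRing R] (c : τ → R) (a : R) :
    shiftVars c (C a) = C a := aeval_C _ _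

lemma shiftVars_neg_shiftVars {τ R : Type*} [CommRing R] (c : τ → R) (f : MvPolynomial τ R) :
    shiftVars (-c) (shiftVars c f) = f := by
  change ((shiftVars (-c)).comp (shiftVars c)) f = AlgHom.id R _ f
  congr 1
  ext1 j
  rw [AlgHom.comp_apply, shiftVars_X, map_add, shiftVars_X, shiftVars_C]
  simp

lemma wtLE_aeval {σ τ R : Type*} [CommRing R] {w : σ → ℕ} {v : τ → ℕ} {b : ℤ}
    {f : MvPolynomial σ R} (hf : WtLE w b f) {q : σ → MvPolynomial τ R}
    (hq : ∀ j, WtLE v (w j) (q j)) : WtLE v b (aeval q f) := by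
  rw [aeval_def, eval₂_eq]
  refine WtLE.sum _ _ fun e he => ?_
  have h1 := (WtLE.C (w := v) (coeff e f) le_rfl).mul
    (WtLE.prod (w := v) e.support (fun i => q i ^ e i) (fun i => (e i * w i : ℤ)) fun i _ => ?_)
  · intro m hm
    refine (h1 m hm).trans ((le_of_eq ?_).trans (hf e he))
    rw [zero_add, Finsupp.weight_apply, Finsupp.sum]
    push_cast
    simp
  · have := WtLE.prod (w := v) (Finset.range (e i)) (fun _ => q i) (fun _ => (w i : ℤ))
      fun _ _ => hq i
    simpa using this

lemma totalDegree_le_iff_wtLE {τ R : Type*} [CommRing R] {f : MvPolynomial τ R} {N : ℕ} :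
    f.totalDegree ≤ N ↔ WtLE (fun _ : τ => 1) N f := by
  rw [totalDegree, Finset.sup_le_iff]
  refine forall_congr' fun e => imp_congr_right fun _ => ?_
  rw [Finsupp.weight_apply, Nat.cast_le]
  simp

lemma wtLE_shiftVars {τ R : Type*} [CommRing R] {w : τ → ℕ} {b : ℤ} {f : MvPolynomial τ R}
    (hf : WtLE w b f) (c : τ → R) : WtLE w b (shiftVars c f) :=
  wtLE_aeval hf fun j => (WtLE.X j le_rfl).add (WtLE.C _ (Nat.cast_nonneg _))

lemma lieDer_shiftVars {R : Type*} [CommRing R] {n : ℕ} (c : Fin n → R)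
    (g : Fin n → MvPolynomial (Fin n) R) (f : MvPolynomial (Fin n) R) :
    lieDer (fun i => shiftVars c (g i)) (shiftVars c f) = shiftVars c (lieDer g f) := by
  induction f using MvPolynomial.induction_on with
  | C a => simp [lieDer]
  | add p q hp hq => simp only [map_add, hp, hq]
  | mul_X p i hp =>
    rw [map_mul, Derivation.leibniz, hp, Derivation.leibniz, map_add, smul_eq_mul, smul_eq_mul,
      smul_eq_mul, smul_eq_mul, map_mul, map_mul, shiftVars_X, map_add, lieDer_X, lieDer_X]
    simp [lieDer]

lemma jet_shiftVars {R : Type*} [CommRing R] {n : ℕ} [NeZero n] (c : Fin n → R)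
    (g : Fin n → MvPolynomial (Fin n) R) (j : ℕ) :
    jet (fun i => shiftVars c (g i)) j + C (if j = 0 then c 0 else 0) = shiftVars c (jet g j) := by
  induction j with
  | zero => rw [jet_zero, jet_zero, shiftVars_X, if_pos rfl]
  | succ j ih =>
    rw [jet_succ, jet_succ, ← lieDer_shiftVars, ← ih, map_add, if_neg (Nat.succ_ne_zero j)]
    simp [lieDer]

lemma exists_open_simplex_generator (K : Type*) [Field K] [CharZero K] {n d D : ℕ} [NeZero n]
    (hd : 0 < d) (hD : 0 < D) (hdD : d ≤ D) :
    ∃ P : MvPolynomial (CoeffIdx n d D) K, P ≠ 0 ∧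
      ∀ g : Fin n → MvPolynomial (Fin n) K, Adm d D g → spec K d D g P ≠ 0 →
        ∃ μ : MvPolynomial (Fin (n + 1)) K, aeval (fun j : Fin (n + 1) => jet g j) μ = 0 ∧
          (∀ H, aeval (fun j : Fin (n + 1) => jet g j) H = 0 → μ ∣ H) ∧
          μ.support ⊆ simplexExps n d D ∧
          ∀ k : Fin (n + 1),
            coeff (Finsupp.single k (∏ i : Fin n, jetWt d D (k.succAbove i))) μ ≠ 0 := by
  choose P hP hPg using fun k : Fin (n + 1) =>
    exists_open_stair (K := K) (n := n) hd hD k (∑ j : Fin (n + 1), jetWt d D j)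
  obtain ⟨Q, hQ, hQg⟩ := exists_open_simplexExps_erase K (n := n) hd hD
  refine ⟨(∏ k, P k) * Q, mul_ne_zero (Finset.prod_ne_zero_iff.2 fun k _ => hP k) hQ, ?_⟩
  intro g hg hne
  rw [map_mul, map_prod, mul_ne_zero_iff, Finset.prod_ne_zero_iff] at hne
  exact exists_simplex_generator (p := jet g) hd (fun j _ => totalDegree_jet_le hD hdD hg j)
    (fun k => hPg k g hg (hne.1 k (Finset.mem_univ _))) le_rfl (hQg g hg hne.2)

lemma prod_jetWt_succAbove_zero {n d D : ℕ} :
    ∏ i : Fin n, jetWt d D ((0 : Fin (n + 1)).succAbove i) = ∏ j : Fin (n + 1), jetWt d D j := by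
  rw [Fin.prod_univ_succ]
  simp [jetWt_zero]

lemma aeval_shiftVars {τ R S : Type*} [CommRing R] [CommRing S] [Algebra R S] (p : τ → S)
    (c : τ → R) (f : MvPolynomial τ R) :
    aeval p (shiftVars c f) = aeval (fun j => p j + algebraMap R S (c j)) f := by
  rw [shiftVars, comp_aeval_apply]
  simp

lemma eq_zero_of_shiftVars {K : Type*} [Field K] {n d D : ℕ} [NeZero n] (hd : 0 < d)
    {g : Fin n → MvPolynomial (Fin n) K} {μ : MvPolynomial (Fin (n + 1)) K}
    (hdvd : ∀ H, aeval (fun j : Fin (n + 1) => jet g j) H = 0 → μ ∣ H)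
    (htop : coeff (Finsupp.single 0 (∏ j : Fin (n + 1), jetWt d D j)) μ ≠ 0) {c : K}
    (hc : eval (Pi.single 0 c) μ ≠ 0) {G : MvPolynomial (Fin (n + 1)) K}
    (hG : G.support ⊆ (simplexExps n d D).erase 0)
    (hG0 : aeval (fun j : Fin (n + 1) => jet (fun i => shiftVars (Pi.single 0 c) (g i)) j) G = 0) :
    G = 0 := by
  have hw : ∀ j : Fin (n + 1), 0 < jetWt d D j := fun j => jetWt_pos hd D j
  set c' : Fin (n + 1) → K := Pi.single 0 c with hc'
  have hrel : aeval (fun j : Fin (n + 1) => jet g j) (shiftVars (-c') G) = 0 := by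
    have h2 : ∀ j : Fin (n + 1), jet g j + algebraMap K (MvPolynomial (Fin n) K) ((-c') j) =
        shiftVars (-Pi.single 0 c) (jet (fun i => shiftVars (Pi.single 0 c) (g i)) j) := by
      intro j
      have h3 := jet_shiftVars (-Pi.single 0 c : Fin n → K)
        (fun i => shiftVars (Pi.single 0 c) (g i)) j
      simp only [shiftVars_neg_shiftVars] at h3
      rw [← h3]
      refine Fin.cases ?_ (fun j => ?_) j
      · simp [hc', algebraMap_eq]
      · simp [hc', algebraMap_eq]
    rw [aeval_shiftVars, funext h2, ← comp_aeval_apply, hG0, map_zero]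
  have hwt : WtLE (fun j : Fin (n + 1) => jetWt d D j) (∏ j : Fin (n + 1), jetWt d D j : ℕ)
      (shiftVars (-c') G) :=
    wtLE_shiftVars ((wtLE_iff_support_subset hd).2 (hG.trans (Finset.erase_subset _ _))) _
  obtain ⟨a, ha⟩ := exists_eq_mul_C_of_wtLE hw (hdvd _ hrel) hwt htop
    (by simp [Finsupp.weight_single, jetWt_zero])
  have hev : eval c' (shiftVars (-c') G) = coeff 0 G := by
    rw [← constantCoeff_eq, ← MvPolynomial.eval_zero, ← MvPolynomial.coe_aeval_eq_eval,
      ← MvPolynomial.coe_aeval_eq_eval]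
    refine (aeval_shiftVars _ _ _).trans ?_
    refine congrArg (fun y : Fin (n + 1) → K => aeval y G) ?_
    ext1 j
    simp
  have hG00 : coeff 0 G = 0 := by
    by_contra h
    exact Finset.notMem_erase _ _ (hG (mem_support_iff.2 h))
  rw [hG00, ha, map_mul, eval_C] at hev
  rw [(mul_eq_zero.1 hev).resolve_left hc, C_0, mul_zero] at ha
  rw [← shiftVars_neg_shiftVars (-c') G, ha, map_zero]

lemma exists_open_simplexExps_erase_zero (K : Type*) [Field K] [CharZero K] {n d D : ℕ} [NeZero n]
    (hd : 0 < d) (hD : 0 < D) (hdD : d ≤ D) :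
    ∃ P : MvPolynomial (CoeffIdx n d D) K, P ≠ 0 ∧
      ∀ g : Fin n → MvPolynomial (Fin n) K, Adm d D g → spec K d D g P ≠ 0 →
        ∀ G : MvPolynomial (Fin (n + 1)) K, G.support ⊆ (simplexExps n d D).erase 0 →
          aeval (fun j : Fin (n + 1) => jet g j) G = 0 → G = 0 := by
  obtain ⟨P, hP, hPg⟩ := exists_open_simplex_generator K (n := n) hd hD hdD
  obtain ⟨g, hg, hgP⟩ := exists_adm_spec_ne_zero hP
  obtain ⟨μ, -, hdvd, -, hcoeff⟩ := hPg g hg hgP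
  have htop := hcoeff 0
  rw [prod_jetWt_succAbove_zero] at htop
  obtain ⟨c, hc⟩ : ∃ c : K, eval (Pi.single 0 c) μ ≠ 0 := by
    by_contra! h
    rw [← coeff_aeval_pi_single] at htop
    have h1 : aeval (Pi.single 0 (Polynomial.X : Polynomial K)) μ = 0 := by
      refine Polynomial.funext fun c => ?_
      rw [Polynomial.eval_zero, ← h c, ← Polynomial.coe_aeval_eq_eval,
        ← MvPolynomial.coe_aeval_eq_eval]
      refine (comp_aeval_apply _ (Polynomial.aeval c) μ).trans ?_
      refine congrArg (fun y : Fin (n + 1) → K => aeval y μ) ?_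
      ext1 j
      refine Fin.cases ?_ (fun j => ?_) j
      · simp
      · simp
    rw [h1, Polynomial.coeff_zero] at htop
    exact htop rfl
  set h : Fin n → MvPolynomial (Fin n) K := fun i => shiftVars (Pi.single 0 c) (g i) with hh
  have hmap : ∀ q : MvPolynomial (Fin n) K,
      map (Polynomial.evalRingHom (0 : K)) (map Polynomial.C q) = q := by
    intro q
    rw [map_map]
    convert map_id q
    ext
    simp
  have hadm : Adm d D fun i => map (Polynomial.C : K →+* Polynomial K) (h i) := by
    intro i
    refine (Finset.sup_mono (support_map_subset _ _)).trans ?_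
    exact totalDegree_le_iff_wtLE.2 (wtLE_shiftVars (totalDegree_le_iff_wtLE.1 (hg i)) _)
  refine exists_open_forall_eq_zero _ hadm (fun _ => 0)
    (fun j => jet (fun i => map (Polynomial.C : K →+* Polynomial K) (h i)) j)
    (fun j _ => by simp) fun G hG h0 => ?_
  refine eq_zero_of_shiftVars hd hdvd htop hc hG ?_
  rw [← h0]
  congr 2
  ext1 j
  rw [map_jet]
  simp only [hmap, hh]

/-- The position of `x_1^{(k)}` among the differential indeterminates. -/
def jetVar (n : ℕ) [NeZero n] (k : Fin (n + 1)) : Fin n × ℕ := (0, k)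

lemma jetVar_injective (n : ℕ) [NeZero n] : Function.Injective (jetVar n) :=
  fun _ _ h => Fin.ext (congrArg Prod.snd h)

lemma jetEval_rename_jetVar {B : Type*} [CommRing B] {n : ℕ} [NeZero n]
    (g : Fin n → MvPolynomial (Fin n) B) (H : MvPolynomial (Fin (n + 1)) B) :
    jetEval g (rename (jetVar n) H) = aeval (fun j : Fin (n + 1) => jet g j) H := by
  rw [jetEval, aeval_rename]
  rfl

lemma exists_of_mem_vars_rename_jetVar {B : Type*} [CommRing B] {n : ℕ} [NeZero n]
    {H : MvPolynomial (Fin (n + 1)) B} {v : Fin n × ℕ} (hv : v ∈ (rename (jetVar n) H).vars) :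
    ∃ k : Fin (n + 1), jetVar n k = v := by
  classical
  obtain ⟨k, -, hk⟩ := Finset.mem_image.1 (vars_rename (jetVar n) H hv)
  exact ⟨k, hk⟩

lemma ordOf_rename_jetVar_le {B : Type*} [CommRing B] {n : ℕ} [NeZero n]
    (H : MvPolynomial (Fin (n + 1)) B) : ordOf (rename (jetVar n) H) ≤ n := by
  refine Finset.sup_le fun v hv => ?_
  obtain ⟨k, rfl⟩ := exists_of_mem_vars_rename_jetVar hv
  exact k.is_le

lemma exists_eq_rename_jetVar {B : Type*} [CommRing B] {n : ℕ} [NeZero n]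
    {h : MvPolynomial (Fin n × ℕ) B} (hv : ∀ v ∈ h.vars, v.1 = 0) (ho : ordOf h ≤ n) :
    ∃ H, rename (jetVar n) H = h := by
  refine exists_rename_eq_of_vars_subset_range h _ (jetVar_injective n) fun v hmem => ?_
  have h1 : v.2 ≤ n := (Finset.le_sup (f := Prod.snd) hmem).trans ho
  exact ⟨⟨v.2, by omega⟩, Prod.ext (hv v hmem).symm rfl⟩

lemma le_ordOf_rename_of_dvd {K : Type*} [Field K] {n : ℕ} [NeZero n]
    {μ H : MvPolynomial (Fin (n + 1)) K} (hH : H ≠ 0) (hdvd : μ ∣ H)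
    (hμ : μ.degreeOf (Fin.last n) ≠ 0) : n ≤ ordOf (rename (jetVar n) H) := by
  obtain ⟨ν, rfl⟩ := hdvd
  have h1 : jetVar n (Fin.last n) ∈ (rename (jetVar n) (μ * ν)).vars := by
    rw [mem_vars_iff_degreeOf_ne_zero, degreeOf_rename_of_injective (jetVar_injective n),
      degreeOf_mul_eq (left_ne_zero_of_mul hH) (right_ne_zero_of_mul hH)]
    omega
  exact Finset.le_sup (f := Prod.snd) h1

lemma isMinPoly_rename {K : Type*} [Field K] {n : ℕ} [NeZero n]
    {g : Fin n → MvPolynomial (Fin n) K} {μ : MvPolynomial (Fin (n + 1)) K} (hμ0 : μ ≠ 0)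
    (hμ : aeval (fun j : Fin (n + 1) => jet g j) μ = 0)
    (hdvd : ∀ H, aeval (fun j : Fin (n + 1) => jet g j) H = 0 → μ ∣ H)
    (hlast : μ.degreeOf (Fin.last n) ≠ 0) :
    IsMinPoly K n (sysIdeal K n g) (rename (jetVar n) μ) := by
  have hinj := rename_injective (R := K) _ (jetVar_injective n)
  refine ⟨(map_ne_zero_iff _ hinj).2 hμ0, ?_, ?_, ?_⟩
  · rwa [mem_sysIdeal_iff, jetEval_rename_jetVar]
  · intro v hv
    obtain ⟨k, rfl⟩ := exists_of_mem_vars_rename_jetVar hv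
    rfl
  · intro h h0 hI hv
    by_cases ho : ordOf h ≤ n
    · obtain ⟨H, rfl⟩ := exists_eq_rename_jetVar hv ho
      rw [mem_sysIdeal_iff, jetEval_rename_jetVar] at hI
      refine ⟨(ordOf_rename_jetVar_le _).trans
        (le_ordOf_rename_of_dvd ((map_ne_zero_iff _ hinj).1 h0) (hdvd H hI) hlast), fun _ => ?_⟩
      exact totalDegree_le_of_dvd_of_isDomain (map_dvd _ (hdvd H hI)) h0
    · have h1 := ordOf_rename_jetVar_le μ
      exact ⟨by omega, fun h2 => by omega⟩

lemma IsMinPoly.exists_eq_rename_mul_C {K : Type*} [Field K] {n : ℕ} [NeZero n]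
    {g : Fin n → MvPolynomial (Fin n) K} {μ : MvPolynomial (Fin (n + 1)) K} (hμ0 : μ ≠ 0)
    (hμ : aeval (fun j : Fin (n + 1) => jet g j) μ = 0)
    (hdvd : ∀ H, aeval (fun j : Fin (n + 1) => jet g j) H = 0 → μ ∣ H)
    (hlast : μ.degreeOf (Fin.last n) ≠ 0) {f : MvPolynomial (Fin n × ℕ) K}
    (hf : IsMinPoly K n (sysIdeal K n g) f) :
    ∃ a : K, a ≠ 0 ∧ f = rename (jetVar n) (μ * C a) := by
  have hinj := rename_injective (R := K) _ (jetVar_injective n)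
  have hmin := isMinPoly_rename hμ0 hμ hdvd hlast
  obtain ⟨hf0, hfI, hfv, hfmin⟩ := hf
  have h1 := hfmin _ hmin.1 hmin.2.1 hmin.2.2.1
  obtain ⟨H, rfl⟩ := exists_eq_rename_jetVar hfv (h1.1.trans (ordOf_rename_jetVar_le μ))
  have hH0 := (map_ne_zero_iff _ hinj).1 hf0
  rw [mem_sysIdeal_iff, jetEval_rename_jetVar] at hfI
  have h2 := h1.2 ((ordOf_rename_jetVar_le μ).trans (le_ordOf_rename_of_dvd hH0 (hdvd H hfI) hlast))
  obtain ⟨ν, rfl⟩ := hdvd H hfI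
  rw [map_mul] at h2 hf0
  rw [totalDegree_mul_of_isDomain (left_ne_zero_of_mul hf0) (right_ne_zero_of_mul hf0)] at h2
  have h3 := totalDegree_eq_zero_iff_eq_C.1 (show (rename (jetVar n) ν).totalDegree = 0 by omega)
  refine ⟨coeff 0 (rename (jetVar n) ν), ?_, ?_⟩
  · intro h4
    rw [h4, C_0] at h3
    exact right_ne_zero_of_mul hf0 h3
  · rw [map_mul, map_mul, rename_C, ← h3]

lemma expVecs_rename_jetVar {K : Type*} [CommRing K] {n : ℕ} [NeZero n]
    (H : MvPolynomial (Fin (n + 1)) K) :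
    expVecs K n n (rename (jetVar n) H) =
      {e | ∃ m ∈ H.support, e = fun k => (m k : ℝ)} := by
  classical
  ext e
  simp only [expVecs, support_rename_of_injective (jetVar_injective n), Finset.mem_image,
    Set.mem_ofPred_eq, exists_exists_and_eq_and]
  refine exists_congr fun m => and_congr_right fun _ => ?_
  have h1 : ∀ k : Fin (n + 1), Finsupp.mapDomain (jetVar n) m (0, (k : ℕ)) = m k :=
    fun k => Finsupp.mapDomain_apply (jetVar_injective n) m k
  simp only [h1]

lemma convexHull_eq_simplex {ι : Type*} [Fintype ι] {S : Set (ι →₀ ℕ)} {w a : ι → ℕ} {N : ℕ}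
    (hN : 0 < N) (ha : ∀ k, w k * a k = N)
    (hS : ∀ e ∈ S, Finsupp.weight w e ≤ N) (h0 : 0 ∈ S) (hv : ∀ k, Finsupp.single k (a k) ∈ S) :
    convexHull ℝ {e : ι → ℝ | ∃ m ∈ S, e = fun k => (m k : ℝ)} =
      {e : ι → ℝ | (∀ k, 0 ≤ e k) ∧ ∑ k, (w k : ℝ) * e k ≤ N} := by
  classical
  apply Set.Subset.antisymm
  · refine convexHull_min ?_ ?_
    · rintro e ⟨m, hm, rfl⟩
      refine ⟨fun k => Nat.cast_nonneg _, ?_⟩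
      have h1 := hS m hm
      rw [Finsupp.weight_apply, Finsupp.sum_fintype _ _ (by simp)] at h1
      refine le_trans (le_of_eq ?_) (Nat.cast_le (α := ℝ).2 h1)
      push_cast
      simp [mul_comm]
    · rintro x ⟨hx, hx'⟩ y ⟨hy, hy'⟩ s t hs ht hst
      refine ⟨fun k => ?_, ?_⟩
      · exact add_nonneg (mul_nonneg hs (hx k)) (mul_nonneg ht (hy k))
      · have h1 : ∑ k, (w k : ℝ) * (s • x + t • y) k =
            s * ∑ k, (w k : ℝ) * x k + t * ∑ k, (w k : ℝ) * y k := by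
          rw [Finset.mul_sum, Finset.mul_sum, ← Finset.sum_add_distrib]
          refine Finset.sum_congr rfl fun k _ => ?_
          simp only [Pi.add_apply, Pi.smul_apply, smul_eq_mul]
          ring
        rw [h1]
        calc _ ≤ s * (N : ℝ) + t * N := by gcongr
          _ = N := by rw [← add_mul, hst, one_mul]
  · rintro e ⟨he, he'⟩
    have hN' : (0 : ℝ) < N := Nat.cast_pos.2 hN
    set u : Option ι → ℝ := fun o => o.elim (1 - (∑ k, (w k : ℝ) * e k) / N)
      fun k => w k * e k / N with hu
    set z : Option ι → ι → ℝ := fun o => o.elim 0 fun k => Pi.single k (a k : ℝ) with hz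
    have h1 : ∑ o, u o • z o = e := by
      rw [Fintype.sum_option]
      ext k
      simp only [hu, hz, Option.elim_none, Option.elim_some, smul_zero, zero_add,
        Finset.sum_apply, Pi.smul_apply, smul_eq_mul]
      rw [Finset.sum_eq_single k]
      · rw [Pi.single_eq_same, div_mul_eq_mul_div, div_eq_iff hN'.ne', ← ha k]
        push_cast
        ring
      · intro j _ hj
        rw [Pi.single_eq_of_ne hj.symm, mul_zero]
      · simp
    rw [← h1]
    refine (convex_convexHull ℝ _).sum_mem ?_ ?_ ?_
    · rintro (_ | k) -
      · exact sub_nonneg.2 ((div_le_one hN').2 he')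
      · exact div_nonneg (mul_nonneg (Nat.cast_nonneg _) (he k)) hN'.le
    · rw [Fintype.sum_option]
      simp only [hu, Option.elim_none, Option.elim_some]
      rw [← Finset.sum_div]
      ring
    · rintro (_ | k) -
      · refine subset_convexHull ℝ _ ⟨0, h0, ?_⟩
        ext k
        simp [hz]
      · refine subset_convexHull ℝ _ ⟨_, hv k, ?_⟩
        ext j
        simp only [hz, Option.elim_some, Finsupp.single_apply, Pi.single_apply]
        split_ifs <;> simp_all

lemma prod_jetWt_eq (n d D : ℕ) :
    ∏ j : Fin (n + 1), jetWt d D j = ∏ k ∈ Finset.Icc 1 n, (d + (k - 1) * (D - 1)) := by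
  rw [Fin.prod_univ_succ]
  simp only [Fin.val_zero, jetWt_zero, one_mul, Fin.val_succ, jetWt_succ]
  rw [Fin.prod_univ_eq_prod_range (fun j => d + j * (D - 1)), Finset.range_eq_Ico]
  refine (Finset.prod_Ico_add' (fun k => d + (k - 1) * (D - 1)) 0 n 1).trans ?_
  refine Finset.prod_congr ?_ fun _ _ => rfl
  ext k
  simp only [Finset.mem_Ico, Finset.mem_Icc]
  omega

theorem statement2 (K : Type*) [Field K] [CharZero K] (n d D : ℕ) [NeZero n]
    (hd : 0 < d) (hD : 0 < D) (hdD : d ≤ D) :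
    ∃ P : MvPolynomial (Fin n × (Fin n →₀ ℕ)) K, P ≠ 0 ∧
      (∀ i : Fin n, ∀ m : Fin n →₀ ℕ, (i, m) ∈ P.vars →
        (∑ j, m j) ≤ if i = 0 then d else D) ∧
      ∀ g : Fin n → MvPolynomial (Fin n) K,
        (g 0).totalDegree ≤ d → (∀ i : Fin n, i ≠ 0 → (g i).totalDegree ≤ D) →
        MvPolynomial.eval (fun p : Fin n × (Fin n →₀ ℕ) =>
          MvPolynomial.coeff p.2 (g p.1)) P ≠ 0 →
        (∃ f, IsMinPoly K n (sysIdeal K n g) f) ∧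
        ∀ f : MvPolynomial (Fin n × ℕ) K, IsMinPoly K n (sysIdeal K n g) f →
          ordOf f ≤ n ∧
          newtonPolytope K n n f =
            {e : Fin (n + 1) → ℝ | (∀ k, 0 ≤ e k) ∧
              (∑ k : Fin (n + 1),
                ((if (k : ℕ) = 0 then 1 else d + ((k : ℕ) - 1) * (D - 1) : ℕ) : ℝ) * e k) ≤
                ((∏ k ∈ Finset.Icc 1 n, (d + (k - 1) * (D - 1)) : ℕ) : ℝ)} := by
  classical
  obtain ⟨P, hP, hPg⟩ := exists_open_simplex_generator K (n := n) hd hD hdD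
  obtain ⟨Q, hQ, hQg⟩ := exists_open_simplexExps_erase_zero K (n := n) hd hD hdD
  refine ⟨rename Subtype.val (P * Q), ?_, ?_, ?_⟩
  · exact (map_ne_zero_iff _ (rename_injective _ Subtype.val_injective)).2 (mul_ne_zero hP hQ)
  · intro i m hm
    obtain ⟨⟨p, hp⟩, -, hpm⟩ := Finset.mem_image.1 (vars_rename _ _ hm)
    subst hpm
    exact hp
  · intro g hg0 hg hne
    have hadm : Adm d D g := by
      intro i
      split_ifs with h
      · rwa [h]
      · exact hg i h
    rw [eval_rename, map_mul, mul_ne_zero_iff] at hne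
    have hspec : ∀ R : MvPolynomial (CoeffIdx n d D) K, spec K d D g R =
        eval ((fun p : Fin n × (Fin n →₀ ℕ) => coeff p.2 (g p.1)) ∘ Subtype.val) R :=
      fun R => DFunLike.congr_fun (MvPolynomial.coe_aeval_eq_eval _) R
    obtain ⟨μ, hμ, hdvd, hsupp, hcoeff⟩ := hPg g hadm (by rw [hspec]; exact hne.1)
    have hμ0 : μ ≠ 0 := by
      rintro rfl
      exact hcoeff 0 (coeff_zero _)
    have hconst : coeff 0 μ ≠ 0 := by
      intro h
      refine hμ0 (hQg g hadm (by rw [hspec]; exact hne.2) μ (fun e he => ?_) hμ)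
      refine Finset.mem_erase.2 ⟨?_, hsupp he⟩
      rintro rfl
      exact mem_support_iff.1 he h
    have hlast : μ.degreeOf (Fin.last n) ≠ 0 := by
      have h1 := monomial_le_degreeOf (Fin.last n) (mem_support_iff.2 (hcoeff (Fin.last n)))
      rw [Finsupp.single_eq_same] at h1
      have h2 : 0 < ∏ i : Fin n, jetWt d D ((Fin.last n).succAbove i) :=
        Finset.prod_pos fun i _ => jetWt_pos hd D _
      omega
    refine ⟨⟨_, isMinPoly_rename hμ0 hμ hdvd hlast⟩, fun f hf => ?_⟩
    obtain ⟨a, ha, rfl⟩ := hf.exists_eq_rename_mul_C hμ0 hμ hdvd hlast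
    refine ⟨ordOf_rename_jetVar_le _, ?_⟩
    have hmem : ∀ m, m ∈ (μ * C a).support ↔ m ∈ μ.support := by
      intro m
      rw [mem_support_iff, mem_support_iff, mul_comm, coeff_C_mul, mul_ne_zero_iff, and_iff_right ha]
    simp only [newtonPolytope, expVecs_rename_jetVar, hmem]
    rw [← prod_jetWt_eq]
    exact convexHull_eq_simplex (S := {m | m ∈ μ.support}) (w := fun j : Fin (n + 1) => jetWt d D j)
      (a := fun k => ∏ i : Fin n, jetWt d D (k.succAbove i))
      (Finset.prod_pos fun j _ => jetWt_pos hd D _)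
      (fun k => (Fin.prod_univ_succAbove (fun j : Fin (n + 1) => jetWt d D j) k).symm)
      (fun e he => (mem_simplexExps hd).1 (hsupp he)) (mem_support_iff.2 hconst)
      fun k => mem_support_iff.2 (hcoeff k)
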